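/- arXiv:1607.04954 — 2 statements merged into one kernel-verified Lean document; each statement's English description precedes it below -/
import Mathlib

section
/- There exist t₀ > 0 and constants c₂ ≥ c₄ > 0 such that for i = 1,2, for every real t > t₀ and every integer N > log(t/t₀)/log λ, one has exp(−c₂ t^ν) ≤ G_N^{(i)}(t) ≤ exp(−c₄ t^ν). In particular the family (G_N^{(i)}) satisfies the hypothesis of the exponential Tauberian theorem with exponent ν = log 2 / log λ. -/
/-- The generating-function polynomial Φ¹. -/
noncomputable def Phi1 (x y : ℝ) : ℝ :=
  (15*x^2 + 8*x*y + y^2 + 2*x^2*y + 4*x^3) / 30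

/-- The generating-function polynomial Φ². -/
noncomputable def Phi2 (x y : ℝ) : ℝ :=
  (5*x^2 + 11*x*y + 2*y^2 + 14*x^2*y + 8*x^3 + 5*x*y^2) / 45

/-- The iterates Φⁱ_N of the pair (Φ¹, Φ²): `PhiN i 0` is the i-th coordinate projection
(so that `PhiN i 1 = Φⁱ`), and `PhiN i (N+1) x y = PhiN i N (Φ¹(x,y)) (Φ²(x,y))`. -/
noncomputable def PhiN : Fin 2 → ℕ → ℝ → ℝ → ℝ
  | i, 0, x, y => if i = 0 then x else y
  | i, N+1, x, y => PhiN i N (Phi1 x y) (Phi2 x y)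

/-- λ = (20+√205)/15, the largest eigenvalue of the mean matrix. -/
noncomputable def lam : ℝ := (20 + Real.sqrt 205) / 15

/-- The Laplace transform G_N^{(i)}(t) = Φⁱ_N(exp(−λ^{−N} t), exp(−2λ^{−N} t)). -/
noncomputable def G (i : Fin 2) (N : ℕ) (t : ℝ) : ℝ :=
  PhiN i N (Real.exp (-(t / lam ^ N))) (Real.exp (-(2 * t / lam ^ N)))

lemma lam_bounds : 2 < lam ∧ lam < 3 := by
  unfold lam
  have h1 : (14 : ℝ) < Real.sqrt 205 := Real.lt_sqrt_of_sq_lt (by norm_num)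
  have h2 : Real.sqrt 205 < 15 := (Real.sqrt_lt' (by norm_num)).2 (by norm_num)
  constructor <;> linarith

/-- The second coordinate of the eigenvector `(1, lamRatio)` of the mean matrix for `lam`. -/
noncomputable def lamRatio : ℝ := (5 * lam - 9) / 2

lemma lamRatio_bounds : 1 < lamRatio ∧ lamRatio < 2 := by
  unfold lamRatio lam
  have h1 : (14 : ℝ) < Real.sqrt 205 := Real.lt_sqrt_of_sq_lt (by norm_num)
  have h2 : Real.sqrt 205 < 15 := (Real.sqrt_lt' (by norm_num)).2 (by norm_num)
  constructor <;> linarith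

lemma lam_eq_lamRatio : lam = 9 / 5 + 2 / 5 * lamRatio := by
  unfold lamRatio
  ring

lemma lam_mul_lamRatio : lam * lamRatio = 26 / 15 + 13 / 15 * lamRatio := by
  have h := Real.sq_sqrt (show (0 : ℝ) ≤ 205 by norm_num)
  unfold lamRatio lam
  linarith

lemma Phi1_le_sq {x y M : ℝ} (hx : 0 ≤ x) (hy : 0 ≤ y) (hxM : x ≤ M) (hyM : y ≤ M)
    (hM : M ≤ 1) : 0 ≤ Phi1 x y ∧ Phi1 x y ≤ M ^ 2 := by
  have hM0 : 0 ≤ M := hx.trans hxM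
  have h1 : x ^ 2 ≤ M ^ 2 := by gcongr
  have h2 : x * y ≤ M ^ 2 := by rw [sq]; gcongr
  have h3 : y ^ 2 ≤ M ^ 2 := by gcongr
  have h4 : x ^ 2 * y ≤ x ^ 2 := mul_le_of_le_one_right (by positivity) (hyM.trans hM)
  have h5 : x ^ 3 ≤ x ^ 2 := pow_le_pow_of_le_one hx (hxM.trans hM) (by norm_num)
  unfold Phi1
  exact ⟨by positivity, by linarith⟩

lemma Phi2_le_sq {x y M : ℝ} (hx : 0 ≤ x) (hy : 0 ≤ y) (hxM : x ≤ M) (hyM : y ≤ M)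
    (hM : M ≤ 1) : 0 ≤ Phi2 x y ∧ Phi2 x y ≤ M ^ 2 := by
  have hM0 : 0 ≤ M := hx.trans hxM
  have h1 : x ^ 2 ≤ M ^ 2 := by gcongr
  have h2 : x * y ≤ M ^ 2 := by rw [sq]; gcongr
  have h3 : y ^ 2 ≤ M ^ 2 := by gcongr
  have h4 : x ^ 2 * y ≤ x ^ 2 := mul_le_of_le_one_right (by positivity) (hyM.trans hM)
  have h5 : x ^ 3 ≤ x ^ 2 := pow_le_pow_of_le_one hx (hxM.trans hM) (by norm_num)
  have h6 : x * y ^ 2 ≤ y ^ 2 := mul_le_of_le_one_left (by positivity) (hxM.trans hM)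
  unfold Phi2
  exact ⟨by positivity, by linarith⟩

lemma PhiN_le_pow (i : Fin 2) (k : ℕ) {x y M : ℝ} (hx : 0 ≤ x) (hy : 0 ≤ y) (hxM : x ≤ M)
    (hyM : y ≤ M) (hM : M ≤ 1) : PhiN i k x y ≤ M ^ 2 ^ k := by
  induction k generalizing x y M with
  | zero =>
    simp only [PhiN, pow_zero, pow_one]
    split_ifs <;> assumption
  | succ k ih =>
    obtain ⟨h1, h1'⟩ := Phi1_le_sq hx hy hxM hyM hM
    obtain ⟨h2, h2'⟩ := Phi2_le_sq hx hy hxM hyM hM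
    rw [PhiN, pow_succ', pow_mul]
    exact ih h1 h2 h1' h2' (pow_le_one₀ (hx.trans hxM) hM)

lemma sq_le_Phi1 {x y m : ℝ} (hm : 0 ≤ m) (hx : m ≤ x) (hy : m ≤ y) :
    2 / 5 * m ^ 2 ≤ Phi1 x y := by
  have hx0 : 0 ≤ x := hm.trans hx
  have hy0 : 0 ≤ y := hm.trans hy
  have h1 : m ^ 2 ≤ x ^ 2 := by gcongr
  have h2 : m ^ 2 ≤ x * y := by rw [sq]; gcongr
  have h3 : 0 ≤ x ^ 2 * y := by positivity
  have h4 : 0 ≤ x ^ 3 := by positivity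
  unfold Phi1
  linarith [sq_nonneg y, sq_nonneg m]

lemma sq_le_Phi2 {x y m : ℝ} (hm : 0 ≤ m) (hx : m ≤ x) (hy : m ≤ y) :
    2 / 5 * m ^ 2 ≤ Phi2 x y := by
  have hx0 : 0 ≤ x := hm.trans hx
  have hy0 : 0 ≤ y := hm.trans hy
  have h1 : m ^ 2 ≤ x ^ 2 := by gcongr
  have h2 : m ^ 2 ≤ x * y := by rw [sq]; gcongr
  have h3 : m ^ 2 ≤ y ^ 2 := by gcongr
  have h4 : 0 ≤ x ^ 2 * y := by positivity
  have h5 : 0 ≤ x ^ 3 := by positivity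
  have h6 : 0 ≤ x * y ^ 2 := by positivity
  unfold Phi2
  linarith

lemma pow_le_PhiN (i : Fin 2) (k : ℕ) {x y m : ℝ} (hm : 0 ≤ m) (hx : m ≤ x) (hy : m ≤ y) :
    (2 / 5 * m) ^ 2 ^ k ≤ PhiN i k x y := by
  induction k generalizing x y m with
  | zero =>
    simp only [PhiN, pow_zero, pow_one]
    split_ifs <;> linarith
  | succ k ih =>
    rw [PhiN, pow_succ', pow_mul]
    convert ih (by positivity) (sq_le_Phi1 hm hx hy) (sq_le_Phi2 hm hx hy) using 2
    ring

/-- The deviation of `(x, y)` from the fixed point `(1, 1)` has size comparable with `w` along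
the eigenvector `(1, lamRatio)`, up to a quadratic error from below. -/
structure NearOne (w x y : ℝ) : Prop where
  lower_fst : w - 8 * w ^ 2 ≤ 1 - x
  upper_fst : 1 - x ≤ 2 * w
  lower_snd : lamRatio * (w - 8 * w ^ 2) ≤ 1 - y
  upper_snd : 1 - y ≤ lamRatio * (2 * w)

lemma Phi1_one_sub_bounds {u v : ℝ} (hu : 0 ≤ u) (hv : 0 ≤ v) (hu1 : u ≤ 1) (hv1 : v ≤ 1) :
    1 - Phi1 (1 - u) (1 - v) ≤ 9 / 5 * u + 2 / 5 * v ∧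
      9 / 5 * u + 2 / 5 * v - (29 * u ^ 2 + 12 * (u * v) + v ^ 2) / 30
        ≤ 1 - Phi1 (1 - u) (1 - v) := by
  have h1 : u ^ 2 * v ≤ u ^ 2 := mul_le_of_le_one_right (by positivity) hv1
  have h2 : u ^ 3 ≤ u ^ 2 := pow_le_pow_of_le_one hu hu1 (by norm_num)
  have h3 : 0 ≤ u ^ 2 * v := by positivity
  have h4 : 0 ≤ u ^ 3 := by positivity
  have h5 : 0 ≤ u * v := by positivity
  unfold Phi1
  constructor <;> linarith [sq_nonneg u, sq_nonneg v]

lemma Phi2_one_sub_bounds {u v : ℝ} (hu : 0 ≤ u) (hv : 0 ≤ v) (hu1 : u ≤ 1) (hv1 : v ≤ 1) :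
    1 - Phi2 (1 - u) (1 - v) ≤ 26 / 15 * u + 13 / 15 * v ∧
      26 / 15 * u + 13 / 15 * v - (43 * u ^ 2 + 49 * (u * v) + 7 * v ^ 2) / 45
        ≤ 1 - Phi2 (1 - u) (1 - v) := by
  have h1 : u ^ 2 * v ≤ u ^ 2 := mul_le_of_le_one_right (by positivity) hv1
  have h2 : u ^ 3 ≤ u ^ 2 := pow_le_pow_of_le_one hu hu1 (by norm_num)
  have h3 : 0 ≤ u ^ 2 * v := by positivity
  have h4 : 0 ≤ u ^ 3 := by positivity
  have h5 : 0 ≤ u * v := by positivity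
  have h6 : u * v ^ 2 ≤ v ^ 2 := mul_le_of_le_one_left (by positivity) hu1
  have h7 : 0 ≤ u * v ^ 2 := by positivity
  unfold Phi2
  constructor <;> linarith [sq_nonneg u, sq_nonneg v]

lemma NearOne.step {w x y : ℝ} (h : NearOne w x y) (hw : 0 ≤ w) (hw' : w ≤ 1 / 16) :
    NearOne (lam * w) (Phi1 x y) (Phi2 x y) := by
  obtain ⟨r1, r2⟩ := lamRatio_bounds
  have hl := lam_eq_lamRatio
  have hlr := lam_mul_lamRatio
  obtain ⟨l1, l2⟩ := lam_bounds
  obtain ⟨a1, a2, b1, b2⟩ := h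
  have hpos : 0 ≤ w - 8 * w ^ 2 := by nlinarith
  obtain ⟨u, rfl⟩ : ∃ u, x = 1 - u := ⟨1 - x, by ring⟩
  obtain ⟨v, rfl⟩ : ∃ v, y = 1 - v := ⟨1 - y, by ring⟩
  rw [sub_sub_cancel] at a1 a2 b1 b2
  have hu : 0 ≤ u := hpos.trans a1
  have hv : 0 ≤ v := (mul_nonneg (by linarith) hpos).trans b1
  have hv4 : v ≤ 4 * w := by nlinarith
  obtain ⟨p1, p2⟩ := Phi1_one_sub_bounds hu hv (by linarith) (by linarith)
  obtain ⟨q1, q2⟩ := Phi2_one_sub_bounds hu hv (by linarith) (by linarith)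
  have huu : u ^ 2 ≤ 4 * w ^ 2 := by nlinarith
  have hvv : v ^ 2 ≤ 16 * w ^ 2 := by nlinarith
  have huv : u * v ≤ 8 * w ^ 2 := by nlinarith
  have hw2 : 0 ≤ w ^ 2 := sq_nonneg w
  have hll : 2 * w ^ 2 ≤ (lam ^ 2 - lam) * w ^ 2 := by gcongr; nlinarith
  have e1 : lam * (w - 8 * w ^ 2) = 9 / 5 * (w - 8 * w ^ 2)
      + 2 / 5 * (lamRatio * (w - 8 * w ^ 2)) := by
    rw [hl]; ring
  have e2 : lamRatio * (lam * (w - 8 * w ^ 2)) = 26 / 15 * (w - 8 * w ^ 2)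
      + 13 / 15 * (lamRatio * (w - 8 * w ^ 2)) := by
    linear_combination (w - 8 * w ^ 2) * hlr
  refine ⟨?_, ?_, ?_, ?_⟩
  · linarith
  · have : lam * w = 9 / 5 * w + 2 / 5 * (lamRatio * w) := by rw [hl]; ring
    linarith
  · have : lamRatio * (2 * w ^ 2) ≤ lamRatio * ((lam ^ 2 - lam) * w ^ 2) := by gcongr
    have h3 : w ^ 2 ≤ lamRatio * w ^ 2 := by nlinarith
    linarith
  · have : lamRatio * (lam * w) = 26 / 15 * w + 13 / 15 * (lamRatio * w) := by
      linear_combination w * hlr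
    linarith

lemma NearOne.iterate (j : ℕ) {w x y : ℝ} (h : NearOne w x y) (hw : 0 ≤ w)
    (hj : lam ^ j * w ≤ 1 / 16) :
    ∃ x' y', NearOne (lam ^ j * w) x' y' ∧ ∀ i k, PhiN i (k + j) x y = PhiN i k x' y' := by
  have hl : 1 ≤ lam := by linarith [lam_bounds.1]
  induction j generalizing w x y with
  | zero => exact ⟨x, y, by simpa using h, fun _ _ => rfl⟩
  | succ j ih =>
    have hw' : w ≤ 1 / 16 := (le_mul_of_one_le_left hw (one_le_pow₀ hl)).trans hj
    rw [pow_succ, mul_assoc] at hj ⊢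
    obtain ⟨x', y', h', he⟩ := ih (h.step hw hw') (by positivity) hj
    exact ⟨x', y', h', fun i k => he i k⟩

lemma nearOne_exp {s : ℝ} (hs : 0 ≤ s) (hs' : s ≤ 1 / 16) :
    NearOne s (Real.exp (-s)) (Real.exp (-(2 * s))) := by
  obtain ⟨r1, r2⟩ := lamRatio_bounds
  have quad : ∀ z : ℝ, 0 ≤ z → Real.exp (-z) * (1 + z) ≤ 1 := fun z hz => by
    have h := Real.add_one_le_exp z
    calc Real.exp (-z) * (1 + z) ≤ Real.exp (-z) * Real.exp z := by gcongr; linarith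
      _ = 1 := by rw [← Real.exp_add]; simp
  have h1 := Real.add_one_le_exp (-s)
  have h2 := Real.add_one_le_exp (-(2 * s))
  have h3 := quad s hs
  have h4 := quad (2 * s) (by linarith)
  have hpos : 0 ≤ s - 8 * s ^ 2 := by nlinarith
  refine ⟨?_, ?_, ?_, ?_⟩
  · nlinarith
  · linarith
  · have : lamRatio * (s - 8 * s ^ 2) ≤ 2 * (s - 8 * s ^ 2) := by gcongr
    nlinarith
  · nlinarith

lemma lam_pow_rpow (k : ℕ) : (lam ^ k) ^ (Real.log 2 / Real.log lam) = (2 : ℝ) ^ k := by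
  obtain ⟨l1, l2⟩ := lam_bounds
  have hl : 0 < lam := by linarith
  have hlog : 0 < Real.log lam := Real.log_pos (by linarith)
  rw [Real.rpow_def_of_pos (by positivity), Real.log_pow,
    show (k : ℝ) * Real.log lam * (Real.log 2 / Real.log lam) = k * Real.log 2 by field_simp,
    Real.exp_nat_mul, Real.exp_log (by norm_num)]

lemma exists_scale {t : ℝ} (ht : 1 / 16 < t) {N : ℕ} (hN : t / lam ^ N ≤ 1 / 16) :
    ∃ k ≤ N, t / lam ^ k ≤ 1 / 16 ∧ 1 / 48 ≤ t / lam ^ k := by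
  classical
  obtain ⟨l1, l2⟩ := lam_bounds
  have hl : 0 < lam := by linarith
  have hex : ∃ k, t / lam ^ k ≤ 1 / 16 := ⟨N, hN⟩
  refine ⟨Nat.find hex, Nat.find_min' hex hN, Nat.find_spec hex, ?_⟩
  obtain ⟨m, hm⟩ : ∃ m, Nat.find hex = m + 1 := by
    refine Nat.exists_eq_succ_of_ne_zero fun h0 => ?_
    have := Nat.find_spec hex
    rw [h0] at this
    simp at this
    linarith
  have hmin := Nat.find_min hex (m := m) (by omega)
  rw [hm]
  rw [not_le, lt_div_iff₀ (by positivity)] at hmin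
  rw [le_div_iff₀ (by positivity), pow_succ]
  have : lam ^ m * lam ≤ lam ^ m * 3 := by gcongr
  linarith

/-- There exist t₀ > 0 and constants c₂ ≥ c₄ > 0 such that for i = 1,2, every real
t > t₀ and every integer N > log(t/t₀)/log λ,
exp(−c₂ t^ν) ≤ G_N^{(i)}(t) ≤ exp(−c₄ t^ν), where ν = log 2 / log λ. -/
theorem G_tauberian_hypothesis :
    ∃ t₀ > (0:ℝ), ∃ c₂ c₄ : ℝ, 0 < c₄ ∧ c₄ ≤ c₂ ∧
      ∀ i : Fin 2, ∀ t : ℝ, t₀ < t → ∀ N : ℕ,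
        Real.log (t / t₀) / Real.log lam < (N : ℝ) →
          Real.exp (-(c₂ * t ^ (Real.log 2 / Real.log lam))) ≤ G i N t ∧
          G i N t ≤ Real.exp (-(c₄ * t ^ (Real.log 2 / Real.log lam))) := by
  obtain ⟨l1, l2⟩ := lam_bounds
  obtain ⟨r1, r2⟩ := lamRatio_bounds
  have hl : 0 < lam := by linarith
  have hlog : 0 < Real.log lam := Real.log_pos (by linarith)
  have hlog2 : 0 < Real.log 2 := Real.log_pos (by norm_num)
  have hν0 : 0 ≤ Real.log 2 / Real.log lam := by positivity
  have hν1 : Real.log 2 / Real.log lam ≤ 1 := by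
    rw [div_le_one hlog]
    exact Real.log_le_log (by norm_num) l1.le
  have hc₄ : 0 < Real.log (96 / 95) := Real.log_pos (by norm_num)
  have hc₂ : 0 < Real.log (10 / 3) := Real.log_pos (by norm_num)
  refine ⟨1 / 16, by norm_num, 48 * Real.log (10 / 3), Real.log (96 / 95), hc₄, ?_, ?_⟩
  · have : Real.log (96 / 95) ≤ Real.log (10 / 3) :=
      Real.log_le_log (by norm_num) (by norm_num)
    linarith
  intro i t ht N hN
  have ht0 : 0 < t := by linarith
  have hsN : t / lam ^ N ≤ 1 / 16 := by
    rw [div_lt_iff₀ hlog, ← Real.log_pow, Real.log_lt_log_iff (by positivity) (by positivity)] at hN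
    rw [div_le_iff₀ (by positivity)]
    linarith
  obtain ⟨k, hkN, hk1, hk2⟩ := exists_scale ht hsN
  obtain ⟨j, rfl⟩ := Nat.exists_eq_add_of_le hkN
  have hw : lam ^ j * (t / lam ^ (k + j)) = t / lam ^ k := by
    rw [pow_add]; field_simp
  obtain ⟨x, y, ⟨a1, a2, b1, b2⟩, he⟩ :=
    (nearOne_exp (by positivity) hsN).iterate j (by positivity) (hw.trans_le hk1)
  rw [hw] at a1 a2 b1 b2
  have hkt : lam ^ k ≤ 48 * t := by
    rw [le_div_iff₀ (by positivity)] at hk2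
    linarith
  have htk : t ≤ lam ^ k := by
    rw [div_le_iff₀ (by positivity)] at hk1
    linarith [pow_pos hl k]
  have h2k : t ^ (Real.log 2 / Real.log lam) ≤ (2 : ℝ) ^ k := by
    rw [← lam_pow_rpow]
    gcongr
  have hk2t : (2 : ℝ) ^ k ≤ 48 * t ^ (Real.log 2 / Real.log lam) := by
    rw [← lam_pow_rpow]
    calc (lam ^ k) ^ (Real.log 2 / Real.log lam) ≤ (48 * t) ^ (Real.log 2 / Real.log lam) := by
          gcongr
      _ = 48 ^ (Real.log 2 / Real.log lam) * t ^ (Real.log 2 / Real.log lam) :=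
          Real.mul_rpow (by norm_num) ht0.le
      _ ≤ 48 * t ^ (Real.log 2 / Real.log lam) := by
          gcongr
          exact Real.rpow_le_self_of_one_le (by norm_num) hν1
  have hG : G i (k + j) t = PhiN i k x y := by
    rw [G, mul_div_assoc]
    exact he i k
  have hexp : ∀ c : ℝ, 0 < c → Real.exp (-(Real.log c * 2 ^ k)) = c⁻¹ ^ 2 ^ k := fun c hc => by
    rw [← neg_mul, ← Real.log_inv, mul_comm]
    have := Real.exp_nat_mul (Real.log c⁻¹) (2 ^ k)
    push_cast at this
    rw [this, Real.exp_log (by positivity)]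
  generalize t / lam ^ k = w at *
  have hdef : 1 / 96 ≤ w - 8 * w ^ 2 := by nlinarith
  rw [hG]
  constructor
  · calc Real.exp (-(48 * Real.log (10 / 3) * t ^ (Real.log 2 / Real.log lam)))
        ≤ Real.exp (-(Real.log (10 / 3) * 2 ^ k)) := by
          rw [Real.exp_le_exp, neg_le_neg_iff, mul_comm 48, mul_assoc]
          gcongr
      _ = (2 / 5 * (3 / 4)) ^ 2 ^ k := by
          rw [hexp _ (by norm_num)]
          norm_num
      _ ≤ PhiN i k x y := pow_le_PhiN i k (by norm_num) (by linarith) (by nlinarith)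
  · calc PhiN i k x y ≤ (95 / 96) ^ 2 ^ k :=
          PhiN_le_pow i k (by linarith) (by nlinarith) (by linarith) (by nlinarith) (by norm_num)
      _ = Real.exp (-(Real.log (96 / 95) * 2 ^ k)) := by
          rw [hexp _ (by norm_num)]
          norm_num
      _ ≤ Real.exp (-(Real.log (96 / 95) * t ^ (Real.log 2 / Real.log lam))) := by
          gcongr
end

section
/- There exist Borel probability measures μ₁ and μ₂ on ℝ, each giving zero mass to (−∞, 0], each absolutely continuous with respect to Lebesgue measure with a density that is strictly positive on (0,∞), and each with finite first moment, such that for i = 1,2 and every real t ≥ 0, lim_{N→∞} G_N^{(i)}(t) = ∫ e^{−tx} μ_i(dx). -/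
open MeasureTheory

open Filter Topology FourierTransform
open scoped NNReal

/-- Lévy's continuity theorem, including the existence of the limit. -/
theorem exists_tendsto_of_tendsto_charFun {μ : ℕ → ProbabilityMeasure ℝ} {f : ℝ → ℂ}
    (hf : ContinuousAt f 0)
    (h : ∀ t, Tendsto (fun n ↦ charFun (μ n : Measure ℝ) t) atTop (𝓝 (f t))) :
    ∃ μ₀ : ProbabilityMeasure ℝ, Tendsto μ atTop (𝓝 μ₀) ∧ ∀ t, charFun (μ₀ : Measure ℝ) t = f t := by
  have h_tight := isTightMeasureSet_of_tendsto_charFun (μ := fun n ↦ (μ n : Measure ℝ)) hf h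
  have h_compact : IsCompact (closure {μ n | n}) :=
    isCompact_closure_of_isTightMeasureSet (by
      convert h_tight using 1
      ext x
      simp)
  obtain ⟨μ₀, -, hμ₀⟩ := h_compact.ultrafilter_le_nhds ((hyperfilter ℕ).map μ)
    (.trans (by simp) (monotone_principal subset_closure))
  have hμ₀' : Tendsto μ (hyperfilter ℕ) (𝓝 μ₀) := hμ₀
  have hU : (hyperfilter ℕ : Filter ℕ) ≤ atTop := Nat.hyperfilter_le_atTop
  have key : ∀ t, charFun (μ₀ : Measure ℝ) t = f t := by
    intro t
    refine tendsto_nhds_unique ?_ ((h t).mono_left hU)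
    rw [ProbabilityMeasure.tendsto_iff_forall_integral_rclike_tendsto ℂ] at hμ₀'
    simp_rw [charFun_eq_integral_innerProbChar]
    exact hμ₀' (BoundedContinuousFunction.innerProbChar t)
  refine ⟨μ₀, ?_, key⟩
  rw [ProbabilityMeasure.tendsto_iff_tendsto_charFun]
  intro t
  rw [key]
  exact h t

/-- Fourier inversion for measures, tested against a Schwartz function. -/
theorem integral_schwartz_eq_integral_fourier_charFun {μ : Measure ℝ} [IsProbabilityMeasure μ]
    (hμ : Integrable (charFun μ)) (h : SchwartzMap ℝ ℂ) :
    ∫ x, h x ∂μ = ∫ x, 𝓕 (fun ξ ↦ charFun μ (2 * Real.pi * ξ)) x * h x := by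
  have hint : Integrable (fun ξ : ℝ ↦ charFun μ (2 * Real.pi * ξ)) :=
    hμ.comp_mul_left' (by positivity)
  have h1 := VectorFourier.integral_fourierIntegral_smul_eq_flip (μ := μ) (ν := volume)
    (L := innerₗ ℝ) (f := 1) (g := 𝓕⁻ (h : ℝ → ℂ)) Real.continuous_fourierChar
    (by exact continuous_inner) (integrable_const (1 : ℂ))
    (by rw [← SchwartzMap.fourierInv_coe]; exact SchwartzMap.integrable _)
  have h2 := VectorFourier.integral_fourierIntegral_smul_eq_flip (μ := volume) (ν := volume)
    (L := innerₗ ℝ) (f := fun ξ ↦ charFun μ (2 * Real.pi * ξ)) (g := (h : ℝ → ℂ))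
    Real.continuous_fourierChar (by exact continuous_inner) hint (SchwartzMap.integrable _)
  have hflip : (innerₗ ℝ : ℝ →ₗ[ℝ] ℝ →ₗ[ℝ] ℝ).flip = innerₗ ℝ := by
    ext; simp
  rw [hflip] at h1 h2
  have h3 : ∀ x, VectorFourier.fourierIntegral Real.fourierChar volume (innerₗ ℝ)
      (𝓕⁻ (h : ℝ → ℂ)) x = h x := by
    intro x
    change 𝓕 (𝓕⁻ (h : ℝ → ℂ)) x = h x
    rw [← SchwartzMap.fourierInv_coe, ← SchwartzMap.fourier_coe]
    simp
  have h4 : ∀ ξ, VectorFourier.fourierIntegral Real.fourierChar μ (innerₗ ℝ) 1 ξ =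
      charFun μ (-(2 * Real.pi * ξ)) := by
    intro ξ
    rw [charFun_eq_fourierIntegral']
    congr 1
    simp only [smul_eq_mul]
    field_simp
  simp only [h3, h4, Pi.one_apply, smul_eq_mul, one_mul] at h1
  rw [← h1]
  change _ = ∫ x, VectorFourier.fourierIntegral Real.fourierChar volume (innerₗ ℝ)
    (fun ξ ↦ charFun μ (2 * Real.pi * ξ)) x * h x
  simp only [smul_eq_mul] at h2
  rw [h2, ← integral_neg_eq_self]
  refine integral_congr_ae (.of_forall fun ξ ↦ ?_)
  simp only [mul_neg, neg_neg]
  congr 1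
  rw [Real.fourierInv_eq_fourier_neg, neg_neg]
  rfl

/-- A smooth bump sequence approximating the indicator of an open interval. -/
noncomputable def intervalBump (a b : ℝ) (n : ℕ) (x : ℝ) : ℝ :=
  Real.smoothTransition (n * (x - a)) * Real.smoothTransition (n * (b - x))

theorem contDiff_intervalBump (a b : ℝ) (n : ℕ) : ContDiff ℝ (↑(⊤ : ℕ∞)) (intervalBump a b n) :=
  (Real.smoothTransition.contDiff.comp (by fun_prop)).mul
    (Real.smoothTransition.contDiff.comp (by fun_prop))

theorem intervalBump_nonneg (a b : ℝ) (n : ℕ) (x : ℝ) : 0 ≤ intervalBump a b n x :=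
  mul_nonneg (Real.smoothTransition.nonneg _) (Real.smoothTransition.nonneg _)

theorem intervalBump_le_one (a b : ℝ) (n : ℕ) (x : ℝ) : intervalBump a b n x ≤ 1 :=
  mul_le_one₀ (Real.smoothTransition.le_one _) (Real.smoothTransition.nonneg _)
    (Real.smoothTransition.le_one _)

theorem intervalBump_eq_zero {a b : ℝ} (n : ℕ) {x : ℝ} (hx : x ∉ Set.Ioo a b) :
    intervalBump a b n x = 0 := by
  rw [Set.mem_Ioo, not_and_or, not_lt, not_lt] at hx
  rcases hx with hx | hx
  · rw [intervalBump, Real.smoothTransition.zero_of_nonpos, zero_mul]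
    exact mul_nonpos_of_nonneg_of_nonpos (by positivity) (by linarith)
  · rw [intervalBump, Real.smoothTransition.zero_of_nonpos (x := n * (b - x)), mul_zero]
    exact mul_nonpos_of_nonneg_of_nonpos (by positivity) (by linarith)

theorem tendsto_intervalBump (a b x : ℝ) :
    Tendsto (fun n ↦ intervalBump a b n x) atTop (𝓝 ((Set.Ioo a b).indicator 1 x)) := by
  by_cases hx : x ∈ Set.Ioo a b
  · rw [Set.indicator_of_mem hx]
    have h1 : ∀ c : ℝ, 0 < c → ∀ᶠ n : ℕ in atTop, 1 ≤ n * c := fun c hc ↦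
      (tendsto_natCast_atTop_atTop.atTop_mul_const hc).eventually_ge_atTop 1
    refine tendsto_const_nhds.congr' ?_
    filter_upwards [h1 (x - a) (by linarith [hx.1]), h1 (b - x) (by linarith [hx.2])] with n h1 h2
    rw [intervalBump, Real.smoothTransition.one_of_one_le h1,
      Real.smoothTransition.one_of_one_le h2]
    simp
  · rw [Set.indicator_of_notMem hx]
    simp only [intervalBump_eq_zero _ hx]
    exact tendsto_const_nhds

/-- A probability measure on `ℝ` with integrable characteristic function has a continuous
density. -/
theorem exists_continuous_density_of_integrable_charFun {μ : Measure ℝ} [IsProbabilityMeasure μ]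
    (hμ : Integrable (charFun μ)) :
    ∃ F : ℝ → ℝ, Continuous F ∧ (∀ x, 0 ≤ F x) ∧
      μ = volume.withDensity (fun x ↦ ENNReal.ofReal (F x)) := by
  have hint : Integrable (fun ξ : ℝ ↦ charFun μ (2 * Real.pi * ξ)) :=
    hμ.comp_mul_left' (by positivity)
  set F₀ : ℝ → ℂ := 𝓕 (fun ξ ↦ charFun μ (2 * Real.pi * ξ)) with hF₀
  have hF₀c : Continuous F₀ := VectorFourier.fourierIntegral_continuous Real.continuous_fourierChar
    (by exact continuous_inner) hint
  have hFc : Continuous (fun x ↦ (F₀ x).re) := Complex.continuous_re.comp hF₀c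
  have hIoo : ∀ a b, μ.real (Set.Ioo a b) = ∫ x in Set.Ioo a b, (F₀ x).re := by
    intro a b
    have hsupp : ∀ n, HasCompactSupport (fun x ↦ (intervalBump a b n x : ℂ)) := fun n ↦
      HasCompactSupport.of_support_subset_isCompact (isCompact_Icc (a := a) (b := b)) (by
        intro x hx
        by_contra h
        refine hx ?_
        simp [intervalBump_eq_zero n (fun h' ↦ h (Set.Ioo_subset_Icc_self h'))])
    have hsmooth : ∀ n, ContDiff ℝ (↑(⊤ : ℕ∞)) (fun x ↦ (intervalBump a b n x : ℂ)) := fun n ↦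
      Complex.ofRealCLM.contDiff.comp (contDiff_intervalBump a b n)
    have hmeas : ∀ n, Continuous (intervalBump a b n) := fun n ↦
      (contDiff_intervalBump a b n).continuous
    have heq : ∀ n, ∫ x, intervalBump a b n x ∂μ = ∫ x, (F₀ x).re * intervalBump a b n x := by
      intro n
      have h1 := integral_schwartz_eq_integral_fourier_charFun hμ
        ((hsupp n).toSchwartzMap (hsmooth n))
      simp only [HasCompactSupport.toSchwartzMap_toFun, ← hF₀] at h1
      have h2 : Integrable (fun x ↦ F₀ x * (intervalBump a b n x : ℂ)) :=
        Continuous.integrable_of_hasCompactSupport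
          (hF₀c.mul (Complex.continuous_ofReal.comp (hmeas n))) (hsupp n).mul_left
      have h3 := congrArg Complex.re h1
      rw [integral_complex_ofReal, Complex.ofReal_re] at h3
      rw [h3]
      have h4 := integral_re (𝕜 := ℂ) h2
      simp only [RCLike.re_to_complex] at h4
      rw [← h4]
      simp
    have hl : Tendsto (fun n ↦ ∫ x, intervalBump a b n x ∂μ) atTop
        (𝓝 (∫ x, (Set.Ioo a b).indicator 1 x ∂μ)) := by
      refine tendsto_integral_of_dominated_convergence (fun _ ↦ 1)
        (fun n ↦ (hmeas n).aestronglyMeasurable) (integrable_const _) ?_ ?_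
      · exact fun n ↦ .of_forall fun x ↦ by
          rw [Real.norm_of_nonneg (intervalBump_nonneg _ _ _ _)]
          exact intervalBump_le_one _ _ _ _
      · exact .of_forall fun x ↦ tendsto_intervalBump a b x
    have hr : Tendsto (fun n ↦ ∫ x, (F₀ x).re * intervalBump a b n x) atTop
        (𝓝 (∫ x, (F₀ x).re * (Set.Ioo a b).indicator 1 x)) := by
      refine tendsto_integral_of_dominated_convergence
        ((Set.Ioo a b).indicator fun x ↦ ‖(F₀ x).re‖)
        (fun n ↦ (hFc.mul (hmeas n)).aestronglyMeasurable) ?_ ?_ ?_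
      · rw [integrable_indicator_iff measurableSet_Ioo]
        exact (hFc.norm.integrableOn_Icc (a := a) (b := b)).mono_set Set.Ioo_subset_Icc_self
      · refine fun n ↦ .of_forall fun x ↦ ?_
        by_cases hx : x ∈ Set.Ioo a b
        · rw [Set.indicator_of_mem hx, norm_mul,
            Real.norm_of_nonneg (intervalBump_nonneg _ _ _ _)]
          exact mul_le_of_le_one_right (norm_nonneg _) (intervalBump_le_one _ _ _ _)
        · simp [intervalBump_eq_zero n hx, hx]
      · exact .of_forall fun x ↦ (tendsto_intervalBump a b x).const_mul _
    have := tendsto_nhds_unique (hl.congr heq) hr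
    rw [integral_indicator_one measurableSet_Ioo] at this
    rw [this, ← integral_indicator measurableSet_Ioo]
    refine integral_congr_ae (.of_forall fun x ↦ ?_)
    by_cases hx : x ∈ Set.Ioo a b <;> simp [hx]
  have hnonneg : ∀ x, 0 ≤ (F₀ x).re := by
    intro x
    by_contra! hx
    obtain ⟨ε, hε, hball⟩ := Metric.mem_nhds_iff.1
      (hFc.continuousAt.preimage_mem_nhds (Iio_mem_nhds hx))
    rw [Real.ball_eq_Ioo] at hball
    have h1 := hIoo (x - ε) (x + ε)
    have h2 : ∫ y in Set.Ioo (x - ε) (x + ε), -(F₀ y).re > 0 := by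
      rw [gt_iff_lt, setIntegral_pos_iff_support_of_nonneg_ae]
      · have : Set.Ioo (x - ε) (x + ε) ⊆ Function.support fun y ↦ -(F₀ y).re := fun y hy ↦ by
          have : (F₀ y).re < 0 := hball hy
          simp [this.ne]
        rw [Set.inter_eq_right.2 this]
        simp [hε]
      · refine (ae_restrict_iff' measurableSet_Ioo).2 (.of_forall fun y hy ↦ ?_)
        have : (F₀ y).re < 0 := hball hy
        simp [this.le]
      · exact (hFc.neg.integrableOn_Icc (a := x - ε) (b := x + ε)).mono_set Set.Ioo_subset_Icc_self
    rw [integral_neg, ← h1] at h2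
    linarith [measureReal_nonneg (μ := μ) (s := Set.Ioo (x - ε) (x + ε))]
  refine ⟨fun x ↦ (F₀ x).re, hFc, hnonneg, ?_⟩
  refine Real.measure_ext_Ioo_rat fun a b ↦ ?_
  rw [withDensity_apply _ measurableSet_Ioo, ← ofReal_integral_eq_lintegral_ofReal
    ((hFc.integrableOn_Icc (a := (a : ℝ)) (b := b)).mono_set Set.Ioo_subset_Icc_self)
    (.of_forall hnonneg), ← hIoo, ofReal_measureReal]

theorem lam_sq : lam ^ 2 = 8 / 3 * lam - 13 / 15 := by
  have h : Real.sqrt 205 ^ 2 = 205 := Real.sq_sqrt (by norm_num)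
  unfold lam
  linear_combination h / 225

theorem lam_gt : 34 / 15 < lam := by
  have : (14 : ℝ) < Real.sqrt 205 := Real.lt_sqrt_of_sq_lt (by norm_num)
  unfold lam
  linarith

theorem lam_lt : lam < 7 / 3 := by
  have : Real.sqrt 205 < 15 := (Real.sqrt_lt' (by norm_num)).2 (by norm_num)
  unfold lam
  linarith

theorem lam_pos : 0 < lam := by linarith [lam_gt]

/-- The offspring generating functions over an arbitrary commutative `ℝ≥0`-algebra. -/
noncomputable def offspring {A : Type*} [CommSemiring A] [Algebra ℝ≥0 A] : Fin 2 → A → A → A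
  | 0, x, y => (1 / 30 : ℝ≥0) • (15 * x ^ 2 + 8 * (x * y) + y ^ 2 + 2 * (x ^ 2 * y) + 4 * x ^ 3)
  | 1, x, y => (1 / 45 : ℝ≥0) •
      (5 * x ^ 2 + 11 * (x * y) + 2 * y ^ 2 + 14 * (x ^ 2 * y) + 8 * x ^ 3 + 5 * (x * y ^ 2))

theorem map_offspring {A B : Type*} [CommSemiring A] [Algebra ℝ≥0 A] [CommSemiring B]
    [Algebra ℝ≥0 B] (f : A →ₐ[ℝ≥0] B) (i : Fin 2) (x y : A) :
    f (offspring i x y) = offspring i (f x) (f y) := by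
  fin_cases i <;> simp [offspring, map_ofNat f]

/-- Iterates of the offspring generating functions, the last step applied outermost. -/
noncomputable def offspringIter {A : Type*} [CommSemiring A] [Algebra ℝ≥0 A] (x y : A) :
    ℕ → Fin 2 → A
  | 0, i => if i = 0 then x else y
  | N + 1, i => offspring i (offspringIter x y N 0) (offspringIter x y N 1)

theorem map_offspringIter {A B : Type*} [CommSemiring A] [Algebra ℝ≥0 A] [CommSemiring B]
    [Algebra ℝ≥0 B] (f : A →ₐ[ℝ≥0] B) (x y : A) (N : ℕ) (i : Fin 2) :
    f (offspringIter x y N i) = offspringIter (f x) (f y) N i := by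
  induction N generalizing i with
  | zero => fin_cases i <;> simp [offspringIter]
  | succ N ih => simp only [offspringIter, map_offspring, ih]

theorem offspringIter_succ' {A : Type*} [CommSemiring A] [Algebra ℝ≥0 A] (x y : A) (N : ℕ)
    (i : Fin 2) :
    offspringIter x y (N + 1) i = offspringIter (offspring 0 x y) (offspring 1 x y) N i := by
  induction N generalizing i with
  | zero => fin_cases i <;> simp [offspringIter]
  | succ N ih => rw [offspringIter, ih, ih, offspringIter]

theorem offspring_zero_complex (x y : ℂ) : offspring 0 x y =
    (15 * x ^ 2 + 8 * (x * y) + y ^ 2 + 2 * (x ^ 2 * y) + 4 * x ^ 3) / 30 := by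
  simp [offspring, Algebra.smul_def, map_ofNat (algebraMap ℝ≥0 ℂ)]
  ring

theorem offspring_one_complex (x y : ℂ) : offspring 1 x y =
    (5 * x ^ 2 + 11 * (x * y) + 2 * y ^ 2 + 14 * (x ^ 2 * y) + 8 * x ^ 3 +
      5 * (x * y ^ 2)) / 45 := by
  simp [offspring, Algebra.smul_def, map_ofNat (algebraMap ℝ≥0 ℂ)]
  ring

theorem PhiN_eq_offspringIter (i : Fin 2) (N : ℕ) (x y : ℝ) :
    PhiN i N x y = offspringIter x y N i := by
  induction N generalizing x y with
  | zero => simp [PhiN, offspringIter]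
  | succ N ih =>
    rw [PhiN, ih, offspringIter_succ']
    congr 1
    · simp [offspring, Phi1, Algebra.smul_def]
      ring
    · simp [offspring, Phi2, Algebra.smul_def]
      ring

theorem offspring_one_one (i : Fin 2) : offspring i (1 : ℂ) 1 = 1 := by
  match i with
  | 0 =>
    rw [offspring_zero_complex]; norm_num
  | 1 =>
    rw [offspring_one_complex]; norm_num

/-- The mean matrix of the offspring distribution. -/
noncomputable def meanMatrix : Fin 2 → Fin 2 → ℝ
  | 0, 0 => 9 / 5
  | 0, 1 => 2 / 5
  | 1, 0 => 26 / 15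
  | 1, 1 => 13 / 15

/-- A positive eigenvector of the mean matrix for the eigenvalue `lam`. -/
noncomputable def eigvec : Fin 2 → ℝ
  | 0 => 1
  | 1 => (lam - 9 / 5) * (5 / 2)

theorem one_le_eigvec (i : Fin 2) : 1 ≤ eigvec i := by
  fin_cases i <;> simp [eigvec]
  linarith [lam_gt]

theorem eigvec_le_two (i : Fin 2) : eigvec i ≤ 2 := by
  fin_cases i <;> simp [eigvec]
  linarith [lam_lt]

theorem meanMatrix_eigvec (i : Fin 2) :
    meanMatrix i 0 * eigvec 0 + meanMatrix i 1 * eigvec 1 = lam * eigvec i := by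
  fin_cases i <;> simp [eigvec, meanMatrix]
  · ring
  · linear_combination -5 / 2 * lam_sq

theorem meanMatrix_nonneg (i j : Fin 2) : 0 ≤ meanMatrix i j := by
  fin_cases i <;> fin_cases j <;> simp [meanMatrix] <;> norm_num

theorem norm_mul_sub_mul_le_of_norm_le_one {a b a' b' : ℂ} (ha : ‖a‖ ≤ 1) (hb' : ‖b'‖ ≤ 1) :
    ‖a * b - a' * b'‖ ≤ ‖a - a'‖ + ‖b - b'‖ := by
  have : a * b - a' * b' = (a - a') * b' + a * (b - b') := by ring
  rw [this]
  refine (norm_add_le _ _).trans ?_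
  rw [norm_mul, norm_mul]
  gcongr
  · exact mul_le_of_le_one_right (norm_nonneg _) hb'
  · exact mul_le_of_le_one_left (norm_nonneg _) ha

theorem norm_add_five_le (a b c d e : ℂ) :
    ‖a + b + c + d + e‖ ≤ ‖a‖ + ‖b‖ + ‖c‖ + ‖d‖ + ‖e‖ := by
  linarith [norm_add_le (a + b + c + d) e, norm_add₄_le (a := a) (b := b) (c := c) (d := d)]

theorem norm_add_six_le (a b c d e f : ℂ) :
    ‖a + b + c + d + e + f‖ ≤ ‖a‖ + ‖b‖ + ‖c‖ + ‖d‖ + ‖e‖ + ‖f‖ := by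
  linarith [norm_add_le (a + b + c + d + e) f, norm_add_five_le a b c d e]

theorem norm_offspring_le_sq (i : Fin 2) {x y : ℂ} {m : ℝ} (hx : ‖x‖ ≤ m) (hy : ‖y‖ ≤ m)
    (hm : m ≤ 1) : ‖offspring i x y‖ ≤ m ^ 2 := by
  have hx1 := hx.trans hm
  have hy1 := hy.trans hm
  have hxx : ‖x ^ 2‖ ≤ m ^ 2 := by rw [norm_pow]; gcongr
  have hyy : ‖y ^ 2‖ ≤ m ^ 2 := by rw [norm_pow]; gcongr
  have hxy : ‖x * y‖ ≤ m ^ 2 := by rw [norm_mul, pow_two]; gcongr; exact (norm_nonneg _).trans hx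
  have hxxx : ‖x ^ 3‖ ≤ m ^ 2 := by
    rw [pow_succ, norm_mul]; exact (mul_le_of_le_one_right (norm_nonneg _) hx1).trans hxx
  have hxxy : ‖x ^ 2 * y‖ ≤ m ^ 2 := by
    rw [norm_mul]; exact (mul_le_of_le_one_right (norm_nonneg _) hy1).trans hxx
  have hxyy : ‖x * y ^ 2‖ ≤ m ^ 2 := by
    rw [norm_mul]; exact (mul_le_of_le_one_left (norm_nonneg _) hx1).trans hyy
  match i with
  | 0 =>
    rw [offspring_zero_complex, norm_div, div_le_iff₀ (by simp)]
    refine (norm_add_five_le _ _ _ _ _).trans ?_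
    simp only [Complex.norm_mul, Complex.norm_ofNat] at *
    linarith
  | 1 =>
    rw [offspring_one_complex, norm_div, div_le_iff₀ (by simp)]
    refine (norm_add_six_le _ _ _ _ _ _).trans ?_
    simp only [Complex.norm_mul, Complex.norm_ofNat] at *
    linarith

theorem norm_offspring_le_one (i : Fin 2) {x y : ℂ} (hx : ‖x‖ ≤ 1) (hy : ‖y‖ ≤ 1) :
    ‖offspring i x y‖ ≤ 1 := by
  simpa using norm_offspring_le_sq i hx hy le_rfl

theorem norm_offspring_sub_le (i : Fin 2) {x y x' y' : ℂ} (hx : ‖x‖ ≤ 1) (hy : ‖y‖ ≤ 1)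
    (hx' : ‖x'‖ ≤ 1) (hy' : ‖y'‖ ≤ 1) :
    ‖offspring i x y - offspring i x' y'‖ ≤
      meanMatrix i 0 * ‖x - x'‖ + meanMatrix i 1 * ‖y - y'‖ := by
  have hxx : ‖x ^ 2‖ ≤ 1 := by rw [norm_pow]; exact pow_le_one₀ (norm_nonneg _) hx
  have hyy' : ‖y' ^ 2‖ ≤ 1 := by rw [norm_pow]; exact pow_le_one₀ (norm_nonneg _) hy'
  have hxx2 : ‖x ^ 2 - x' ^ 2‖ ≤ ‖x - x'‖ + ‖x - x'‖ := by
    rw [pow_two, pow_two]; exact norm_mul_sub_mul_le_of_norm_le_one hx hx'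
  have hyy2 : ‖y ^ 2 - y' ^ 2‖ ≤ ‖y - y'‖ + ‖y - y'‖ := by
    rw [pow_two, pow_two]; exact norm_mul_sub_mul_le_of_norm_le_one hy hy'
  have hxy2 : ‖x * y - x' * y'‖ ≤ ‖x - x'‖ + ‖y - y'‖ := norm_mul_sub_mul_le_of_norm_le_one hx hy'
  have hxxy2 : ‖x ^ 2 * y - x' ^ 2 * y'‖ ≤ ‖x ^ 2 - x' ^ 2‖ + ‖y - y'‖ :=
    norm_mul_sub_mul_le_of_norm_le_one hxx hy'
  have hxxx2 : ‖x ^ 3 - x' ^ 3‖ ≤ ‖x ^ 2 - x' ^ 2‖ + ‖x - x'‖ := by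
    rw [pow_succ, pow_succ]; exact norm_mul_sub_mul_le_of_norm_le_one hxx hx'
  have hxyy2 : ‖x * y ^ 2 - x' * y' ^ 2‖ ≤ ‖x - x'‖ + ‖y ^ 2 - y' ^ 2‖ :=
    norm_mul_sub_mul_le_of_norm_le_one hx hyy'
  match i with
  | 0 =>
    have : offspring 0 x y - offspring 0 x' y' = (15 * (x ^ 2 - x' ^ 2) + 8 * (x * y - x' * y') +
        (y ^ 2 - y' ^ 2) + 2 * (x ^ 2 * y - x' ^ 2 * y') + 4 * (x ^ 3 - x' ^ 3)) / 30 := by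
      rw [offspring_zero_complex, offspring_zero_complex]; ring
    rw [this, norm_div, div_le_iff₀ (by simp)]
    refine (norm_add_five_le _ _ _ _ _).trans ?_
    simp only [Complex.norm_mul, Complex.norm_ofNat, meanMatrix] at *
    linarith
  | 1 =>
    have : offspring 1 x y - offspring 1 x' y' = (5 * (x ^ 2 - x' ^ 2) + 11 * (x * y - x' * y') +
        2 * (y ^ 2 - y' ^ 2) + 14 * (x ^ 2 * y - x' ^ 2 * y') + 8 * (x ^ 3 - x' ^ 3) +
        5 * (x * y ^ 2 - x' * y' ^ 2)) / 45 := by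
      rw [offspring_one_complex, offspring_one_complex]; ring
    rw [this, norm_div, div_le_iff₀ (by simp)]
    refine (norm_add_six_le _ _ _ _ _ _).trans ?_
    simp only [Complex.norm_mul, Complex.norm_ofNat,
      meanMatrix] at *
    linarith

theorem norm_offspring_sub_linear_le (i : Fin 2) {x y : ℂ} {d : ℝ} (hx : ‖x‖ ≤ 1) (hy : ‖y‖ ≤ 1)
    (hxd : ‖x - 1‖ ≤ d) (hyd : ‖y - 1‖ ≤ d) :
    ‖offspring i x y - 1 - (meanMatrix i 0 * (x - 1) + meanMatrix i 1 * (y - 1))‖ ≤ 3 * d ^ 2 := by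
  have hd : 0 ≤ d := (norm_nonneg _).trans hxd
  have hpp : ‖(x - 1) ^ 2‖ ≤ d ^ 2 := by rw [norm_pow]; gcongr
  have hqq : ‖(y - 1) ^ 2‖ ≤ d ^ 2 := by rw [norm_pow]; gcongr
  have hpq : ‖(x - 1) * (y - 1)‖ ≤ d ^ 2 := by rw [norm_mul, pow_two]; gcongr
  have hppy : ‖(x - 1) ^ 2 * y‖ ≤ d ^ 2 := by
    rw [norm_mul]; exact (mul_le_of_le_one_right (norm_nonneg _) hy).trans hpp
  have hppx : ‖(x - 1) ^ 2 * x‖ ≤ d ^ 2 := by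
    rw [norm_mul]; exact (mul_le_of_le_one_right (norm_nonneg _) hx).trans hpp
  have hqqx : ‖(y - 1) ^ 2 * x‖ ≤ d ^ 2 := by
    rw [norm_mul]; exact (mul_le_of_le_one_right (norm_nonneg _) hx).trans hqq
  have hd2 : 0 ≤ d ^ 2 := by positivity
  match i with
  | 0 =>
    have : offspring 0 x y - 1 - (meanMatrix 0 0 * (x - 1) + meanMatrix 0 1 * (y - 1)) =
        (23 * (x - 1) ^ 2 + 12 * ((x - 1) * (y - 1)) + (y - 1) ^ 2 + 2 * ((x - 1) ^ 2 * y) +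
        4 * ((x - 1) ^ 2 * x)) / 30 := by
      rw [offspring_zero_complex]; simp only [meanMatrix]; push_cast; ring
    rw [this, norm_div, div_le_iff₀ (by simp)]
    refine (norm_add_five_le _ _ _ _ _).trans ?_
    simp only [Complex.norm_mul, Complex.norm_ofNat] at *
    linarith
  | 1 =>
    have : offspring 1 x y - 1 - (meanMatrix 1 0 * (x - 1) + meanMatrix 1 1 * (y - 1)) =
        (21 * (x - 1) ^ 2 + 49 * ((x - 1) * (y - 1)) + 2 * (y - 1) ^ 2 + 14 * ((x - 1) ^ 2 * y) +
        8 * ((x - 1) ^ 2 * x) + 5 * ((y - 1) ^ 2 * x)) / 45 := by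
      rw [offspring_one_complex]; simp only [meanMatrix]; push_cast; ring
    rw [this, norm_div, div_le_iff₀ (by simp)]
    refine (norm_add_six_le _ _ _ _ _ _).trans ?_
    simp only [Complex.norm_mul,
      Complex.norm_ofNat] at *
    linarith

/-- The normalised means of the branching process, together with their limits. -/
theorem exists_normalized_means : ∃ (v : ℕ → Fin 2 → ℝ) (u : Fin 2 → ℝ),
    v 0 0 = 1 ∧ v 0 1 = 2 ∧
    (∀ N i, lam * v (N + 1) i = meanMatrix i 0 * v N 0 + meanMatrix i 1 * v N 1) ∧
    (∀ i, 0 < u i) ∧ ∀ i, Tendsto (fun N ↦ v N i) atTop (𝓝 (u i)) := by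
  obtain ⟨κ, hκ⟩ : ∃ κ, κ = 8 / 3 - lam := ⟨_, rfl⟩
  have hlg := lam_gt
  have hll := lam_lt
  have hd : lam - κ ≠ 0 := by rw [hκ]; linarith
  have hd' : 0 < lam - κ := by rw [hκ]; linarith
  have hl0 : lam ≠ 0 := lam_pos.ne'
  obtain ⟨m, hm⟩ : ∃ m : Fin 2 → ℝ, m = ![13 / 5, 52 / 15] := ⟨_, rfl⟩
  obtain ⟨a, ha⟩ : ∃ a : Fin 2 → ℝ, a = ![1, 2] := ⟨_, rfl⟩
  refine ⟨fun N i ↦ (m i - κ * a i) / (lam - κ) + (κ / lam) ^ N * ((lam * a i - m i) / (lam - κ)),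
    fun i ↦ (m i - κ * a i) / (lam - κ), ?_, ?_, ?_, ?_, ?_⟩
  · dsimp only
    rw [pow_zero, one_mul, ← add_div, div_eq_iff hd]
    simp [ha]
  · dsimp only
    rw [pow_zero, one_mul, ← add_div, div_eq_iff hd]
    simp [ha]
    ring
  · intro N i
    have h1 : lam * (m i - κ * a i) =
        meanMatrix i 0 * (m 0 - κ * a 0) + meanMatrix i 1 * (m 1 - κ * a 1) := by
      fin_cases i <;> simp [ha, hm, hκ, meanMatrix]
      · linear_combination lam_sq
      · linear_combination 2 * lam_sq
    have h2 : κ * (lam * a i - m i) =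
        meanMatrix i 0 * (lam * a 0 - m 0) + meanMatrix i 1 * (lam * a 1 - m 1) := by
      fin_cases i <;> simp [ha, hm, hκ, meanMatrix]
      · linear_combination -lam_sq
      · linear_combination -2 * lam_sq
    have h3 : lam * (κ / lam) ^ (N + 1) = (κ / lam) ^ N * κ := by
      rw [pow_succ]; field_simp
    rw [mul_add, ← mul_assoc, h3]
    linear_combination h1 / (lam - κ) + (κ / lam) ^ N * h2 / (lam - κ)
  · intro i
    refine div_pos ?_ hd'
    fin_cases i <;> simp [ha, hm, hκ] <;> linarith
  · intro i
    have : Tendsto (fun N ↦ (κ / lam) ^ N) atTop (𝓝 0) := by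
      refine tendsto_pow_atTop_nhds_zero_of_lt_one (div_nonneg (by linarith) lam_pos.le) ?_
      rw [div_lt_one lam_pos]
      linarith
    simpa using (this.mul_const ((lam * a i - m i) / (lam - κ))).const_add
      ((m i - κ * a i) / (lam - κ))

/-- The Laplace transforms `G`, extended to complex arguments. -/
noncomputable def genC (N : ℕ) (z : ℂ) : Fin 2 → ℂ :=
  offspringIter (Complex.exp (-(z / lam ^ N))) (Complex.exp (-(2 * z / lam ^ N))) N

theorem genC_succ (N : ℕ) (z : ℂ) (i : Fin 2) :
    genC (N + 1) z i = offspring i (genC N (z / lam) 0) (genC N (z / lam) 1) := by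
  have h1 : z / lam ^ (N + 1) = z / lam / (lam : ℂ) ^ N := by rw [pow_succ', div_div]
  have h2 : 2 * z / lam ^ (N + 1) = 2 * (z / lam) / (lam : ℂ) ^ N := by
    rw [pow_succ', ← div_div, mul_div_assoc]
  simp only [genC, offspringIter, h1, h2]

theorem genC_zero (z : ℂ) (i : Fin 2) :
    genC 0 z i = if i = 0 then Complex.exp (-z) else Complex.exp (-(2 * z)) := by
  simp [genC, offspringIter]

theorem ofReal_G (i : Fin 2) (N : ℕ) (t : ℝ) : (G i N t : ℂ) = genC N t i := by
  rw [G, PhiN_eq_offspringIter, genC]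
  have := map_offspringIter ((Algebra.ofId ℝ ℂ).restrictScalars ℝ≥0)
    (Real.exp (-(t / lam ^ N))) (Real.exp (-(2 * t / lam ^ N))) N i
  simpa [Algebra.ofId_apply] using this

theorem re_div_lam_nonneg {z : ℂ} (hz : 0 ≤ z.re) : 0 ≤ (z / lam).re := by
  rw [Complex.div_ofReal_re]
  exact div_nonneg hz lam_pos.le

theorem norm_div_lam (z : ℂ) : ‖z / lam‖ = ‖z‖ / lam := by
  rw [norm_div, Complex.norm_real, Real.norm_of_nonneg lam_pos.le]

theorem norm_exp_neg_le_one {z : ℂ} (hz : 0 ≤ z.re) : ‖Complex.exp (-z)‖ ≤ 1 := by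
  rw [Complex.norm_exp, Real.exp_le_one_iff]
  simpa using hz

theorem norm_exp_neg_sub_one_le {z : ℂ} (hz : 0 ≤ z.re) : ‖Complex.exp (-z) - 1‖ ≤ 2 * ‖z‖ := by
  rcases le_total ‖z‖ 1 with h | h
  · simpa using Complex.norm_exp_sub_one_le (x := -z) (by simpa using h)
  · have := norm_sub_le (Complex.exp (-z)) 1
    rw [norm_one] at this
    linarith [norm_exp_neg_le_one hz]

theorem norm_exp_neg_sub_one_add_le {z : ℂ} (hz : 0 ≤ z.re) :
    ‖Complex.exp (-z) - 1 + z‖ ≤ 3 * ‖z‖ ^ 2 := by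
  rcases le_total ‖z‖ 1 with h | h
  · have := Complex.norm_exp_sub_one_sub_id_le (x := -z) (by simpa using h)
    rw [norm_neg, sub_neg_eq_add] at this
    nlinarith [sq_nonneg ‖z‖]
  · have := norm_add_le (Complex.exp (-z) - 1) z
    have := norm_sub_le (Complex.exp (-z)) 1
    rw [norm_one] at this
    nlinarith [norm_exp_neg_le_one hz]

theorem norm_genC_le_one (N : ℕ) {z : ℂ} (hz : 0 ≤ z.re) (i : Fin 2) : ‖genC N z i‖ ≤ 1 := by
  induction N generalizing z i with
  | zero =>
    rw [genC_zero]
    split_ifs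
    · exact norm_exp_neg_le_one hz
    · exact norm_exp_neg_le_one (by simpa using hz)
  | succ N ih =>
    rw [genC_succ]
    exact norm_offspring_le_one i (ih (re_div_lam_nonneg hz) 0) (ih (re_div_lam_nonneg hz) 1)

theorem norm_genC_sub_one_le (N : ℕ) {z : ℂ} (hz : 0 ≤ z.re) (i : Fin 2) :
    ‖genC N z i - 1‖ ≤ 4 * ‖z‖ * eigvec i := by
  induction N generalizing z i with
  | zero =>
    refine le_trans ?_ (le_mul_of_one_le_right (by positivity) (one_le_eigvec i))
    rw [genC_zero]
    split_ifs
    · linarith [norm_exp_neg_sub_one_le hz, norm_nonneg z]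
    · have := norm_exp_neg_sub_one_le (z := 2 * z) (by simpa using hz)
      rw [norm_mul, Complex.norm_ofNat] at this
      linarith
  | succ N ih =>
    have hz' := re_div_lam_nonneg hz
    rw [genC_succ, ← offspring_one_one i]
    refine (norm_offspring_sub_le i (norm_genC_le_one N hz' 0) (norm_genC_le_one N hz' 1)
      norm_one.le norm_one.le).trans ?_
    have h0 := mul_le_mul_of_nonneg_left (ih hz' 0) (meanMatrix_nonneg i 0)
    have h1 := mul_le_mul_of_nonneg_left (ih hz' 1) (meanMatrix_nonneg i 1)
    refine (add_le_add h0 h1).trans (le_of_eq ?_)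
    rw [norm_div_lam]
    have := lam_pos.ne'
    field_simp
    linear_combination ‖z‖ * meanMatrix_eigvec i

theorem norm_genC_sub_linear_le {v : ℕ → Fin 2 → ℝ} (hv0 : v 0 0 = 1) (hv1 : v 0 1 = 2)
    (hv : ∀ N i, lam * v (N + 1) i = meanMatrix i 0 * v N 0 + meanMatrix i 1 * v N 1)
    (N : ℕ) {z : ℂ} (hz : 0 ≤ z.re) (i : Fin 2) :
    ‖genC N z i - 1 + z * v N i‖ ≤ 96 * ‖z‖ ^ 2 * eigvec i := by
  induction N generalizing z i with
  | zero =>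
    refine le_trans ?_ (le_mul_of_one_le_right (by positivity) (one_le_eigvec i))
    rw [genC_zero]
    match i with
    | 0 =>
      rw [if_pos rfl, hv0, Complex.ofReal_one, mul_one]
      nlinarith [norm_exp_neg_sub_one_add_le hz, norm_nonneg z]
    | 1 =>
      have := norm_exp_neg_sub_one_add_le (z := 2 * z) (by simpa using hz)
      rw [norm_mul, Complex.norm_ofNat] at this
      rw [if_neg one_ne_zero, hv1, Complex.ofReal_ofNat, mul_comm z]
      nlinarith [norm_nonneg z]
  | succ N ih =>
    have hz' := re_div_lam_nonneg hz
    have hd (j : Fin 2) : ‖genC N (z / lam) j - 1‖ ≤ 8 * ‖z‖ / lam := by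
      refine (norm_genC_sub_one_le N hz' j).trans ?_
      rw [norm_div_lam, mul_div_assoc 8]
      nlinarith [eigvec_le_two j, div_nonneg (norm_nonneg z) lam_pos.le]
    have hlin := norm_offspring_sub_linear_le i (norm_genC_le_one N hz' 0)
      (norm_genC_le_one N hz' 1) (hd 0) (hd 1)
    have h0 := mul_le_mul_of_nonneg_left (ih hz' 0) (meanMatrix_nonneg i 0)
    have h1 := mul_le_mul_of_nonneg_left (ih hz' 1) (meanMatrix_nonneg i 1)
    have hvC : (v (N + 1) i : ℂ) = (meanMatrix i 0 * v N 0 + meanMatrix i 1 * v N 1) / lam := by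
      rw [eq_div_iff (by exact_mod_cast lam_pos.ne'), mul_comm]
      exact_mod_cast hv N i
    have key : genC (N + 1) z i - 1 + z * v (N + 1) i =
        (offspring i (genC N (z / lam) 0) (genC N (z / lam) 1) - 1 -
          (meanMatrix i 0 * (genC N (z / lam) 0 - 1) + meanMatrix i 1 * (genC N (z / lam) 1 - 1))) +
        meanMatrix i 0 * (genC N (z / lam) 0 - 1 + z / lam * v N 0) +
        meanMatrix i 1 * (genC N (z / lam) 1 - 1 + z / lam * v N 1) := by
      rw [genC_succ, hvC]; ring
    rw [key]
    refine (norm_add₃_le).trans ?_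
    rw [norm_mul, norm_mul, Complex.norm_real, Complex.norm_real,
      Real.norm_of_nonneg (meanMatrix_nonneg i 0), Real.norm_of_nonneg (meanMatrix_nonneg i 1)]
    refine (add_le_add (add_le_add hlin h0) h1).trans ?_
    rw [norm_div_lam]
    have hsum : 3 * (8 * ‖z‖ / lam) ^ 2 + meanMatrix i 0 * (96 * (‖z‖ / lam) ^ 2 * eigvec 0) +
        meanMatrix i 1 * (96 * (‖z‖ / lam) ^ 2 * eigvec 1) =
        (‖z‖ / lam) ^ 2 * (192 + 96 * lam * eigvec i) := by
      linear_combination 96 * (‖z‖ / lam) ^ 2 * meanMatrix_eigvec i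
    have hz2 : 96 * ‖z‖ ^ 2 * eigvec i = (‖z‖ / lam) ^ 2 * (96 * lam ^ 2 * eigvec i) := by
      have := lam_pos.ne'
      field_simp
    rw [hsum, hz2]
    gcongr
    have hl : 2 ≤ lam ^ 2 - lam := by nlinarith [lam_gt]
    nlinarith [one_le_eigvec i]

theorem norm_genC_sub_genC_le {n m m' : ℕ} {D : ℝ} {z : ℂ} (hz : 0 ≤ z.re)
    (h : ∀ j, ‖genC m (z / lam ^ n) j - genC m' (z / lam ^ n) j‖ ≤ D * eigvec j) (i : Fin 2) :
    ‖genC (m + n) z i - genC (m' + n) z i‖ ≤ lam ^ n * D * eigvec i := by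
  induction n generalizing z i with
  | zero => simpa using h i
  | succ n ih =>
    have hz' := re_div_lam_nonneg hz
    have h' (j : Fin 2) : ‖genC (m + n) (z / lam) j - genC (m' + n) (z / lam) j‖ ≤
        lam ^ n * D * eigvec j := by
      refine ih hz' (fun j ↦ ?_) j
      simpa only [div_div, ← pow_succ'] using h j
    rw [← add_assoc, ← add_assoc, genC_succ, genC_succ]
    refine (norm_offspring_sub_le i (norm_genC_le_one _ hz' 0) (norm_genC_le_one _ hz' 1)
      (norm_genC_le_one _ hz' 0) (norm_genC_le_one _ hz' 1)).trans ?_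
    have h0 := mul_le_mul_of_nonneg_left (h' 0) (meanMatrix_nonneg i 0)
    have h1 := mul_le_mul_of_nonneg_left (h' 1) (meanMatrix_nonneg i 1)
    refine (add_le_add h0 h1).trans (le_of_eq ?_)
    linear_combination lam ^ n * D * meanMatrix_eigvec i

theorem exists_genC_limit : ∃ (φ : ℂ → Fin 2 → ℂ) (u : Fin 2 → ℝ), (∀ i, 0 < u i) ∧
    (∀ z, 0 ≤ z.re → ∀ i, Tendsto (fun N ↦ genC N z i) atTop (𝓝 (φ z i))) ∧
    ∀ z, 0 ≤ z.re → ∀ i, ‖φ z i - 1 + z * u i‖ ≤ 96 * ‖z‖ ^ 2 * eigvec i := by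
  obtain ⟨v, u, hv0, hv1, hv, hu, hvu⟩ := exists_normalized_means
  have hlim (z : ℂ) (hz : 0 ≤ z.re) (i : Fin 2) :
      ∃ w, Tendsto (fun N ↦ genC N z i) atTop (𝓝 w) := by
    apply cauchySeq_tendsto_of_complete
    rw [Metric.cauchySeq_iff']
    intro ε hε
    have h1 : Tendsto (fun n : ℕ ↦ 384 * ‖z‖ ^ 2 / lam ^ n) atTop (𝓝 0) :=
      tendsto_const_nhds.div_atTop (tendsto_pow_atTop_atTop_of_one_lt (by linarith [lam_gt]))
    obtain ⟨n, hn⟩ := (h1.eventually_lt_const (half_pos hε)).exists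
    obtain ⟨η, hη0, hη⟩ : ∃ η > 0, 2 * (‖z‖ * η) ≤ ε / 2 := by
      refine ⟨ε / (4 * (‖z‖ + 1)), by positivity, ?_⟩
      rw [← sub_nonneg]
      have : ε / 2 - 2 * (‖z‖ * (ε / (4 * (‖z‖ + 1)))) = ε / (2 * (‖z‖ + 1)) := by
        field_simp
        ring
      rw [this]
      positivity
    have hev : ∃ m, ∀ k ≥ m, ∀ j, |v k j - v m j| < η := by
      have (j : Fin 2) := Metric.cauchySeq_iff.1 (hvu j).cauchySeq η hη0
      choose m hm using this
      refine ⟨max (m 0) (m 1), fun k hk j ↦ ?_⟩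
      have hj : m j ≤ max (m 0) (m 1) := by fin_cases j <;> simp
      exact hm j k (hj.trans hk) _ hj
    obtain ⟨m, hm⟩ := hev
    refine ⟨m + n, fun N hN ↦ ?_⟩
    obtain ⟨k, rfl⟩ : ∃ k, N = k + n := ⟨N - n, by omega⟩
    have hk : m ≤ k := by omega
    set ζ := z / lam ^ n with hζ
    have hln : 0 < lam ^ n := pow_pos lam_pos n
    have hζre : 0 ≤ ζ.re := by
      rw [hζ, ← Complex.ofReal_pow, Complex.div_ofReal_re]
      exact div_nonneg hz hln.le
    have hζn : ‖ζ‖ = ‖z‖ / lam ^ n := by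
      rw [hζ, ← Complex.ofReal_pow, norm_div, Complex.norm_real, Real.norm_of_nonneg hln.le]
    have hD (j : Fin 2) : ‖genC k ζ j - genC m ζ j‖ ≤ (‖ζ‖ * η + 192 * ‖ζ‖ ^ 2) * eigvec j := by
      have e1 := norm_genC_sub_linear_le hv0 hv1 hv k hζre j
      have e2 := norm_genC_sub_linear_le hv0 hv1 hv m hζre j
      have e3 : ‖ζ * (v k j - v m j : ℝ)‖ ≤ ‖ζ‖ * η := by
        rw [norm_mul, Complex.norm_real]
        gcongr
        exact (hm k hk j).le
      have e4 : genC k ζ j - genC m ζ j = (genC k ζ j - 1 + ζ * v k j) -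
          (genC m ζ j - 1 + ζ * v m j) - ζ * (v k j - v m j : ℝ) := by
        push_cast; ring
      rw [e4]
      refine (norm_sub_le _ _).trans ((add_le_add_left (norm_sub_le _ _) _).trans ?_)
      have := le_mul_of_one_le_right (mul_nonneg (norm_nonneg ζ) hη0.le) (one_le_eigvec j)
      linarith
    rw [dist_eq_norm]
    refine (norm_genC_sub_genC_le hz hD i).trans_lt ?_
    have e5 : lam ^ n * (‖ζ‖ * η + 192 * ‖ζ‖ ^ 2) * eigvec i ≤
        lam ^ n * (‖ζ‖ * η + 192 * ‖ζ‖ ^ 2) * 2 := by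
      gcongr
      exact eigvec_le_two i
    have e6 : lam ^ n * (‖ζ‖ * η + 192 * ‖ζ‖ ^ 2) * 2 =
        2 * (‖z‖ * η) + 384 * ‖z‖ ^ 2 / lam ^ n := by
      rw [hζn]; field_simp; ring
    linarith
  choose! φ hφ using hlim
  refine ⟨φ, u, hu, fun z hz i ↦ hφ z hz i, fun z hz i ↦ ?_⟩
  refine le_of_tendsto (((hφ z hz i).sub_const 1).add
    ((Complex.continuous_ofReal.tendsto _ |>.comp (hvu i)).const_mul z)).norm
    (Eventually.of_forall fun N ↦ norm_genC_sub_linear_le hv0 hv1 hv N hz i)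

/-- The probability generating function of the particle types after `N` generations. -/
noncomputable def genPoly (N : ℕ) (i : Fin 2) : Polynomial ℝ≥0 :=
  offspringIter Polynomial.X (Polynomial.X ^ 2) N i

theorem aeval_genPoly {A : Type*} [CommSemiring A] [Algebra ℝ≥0 A] (N : ℕ) (i : Fin 2) (x : A) :
    Polynomial.aeval x (genPoly N i) = offspringIter x (x ^ 2) N i := by
  simp [genPoly, map_offspringIter]

/-- The law of the rescaled process after `N` generations. -/
noncomputable def genMeasure (N : ℕ) (i : Fin 2) : Measure ℝ :=
  ∑ k ∈ (genPoly N i).support, (genPoly N i).coeff k • Measure.dirac (k / lam ^ N : ℝ)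

theorem integral_genMeasure {E : Type*} [NormedAddCommGroup E] [NormedSpace ℝ E] [CompleteSpace E]
    (N : ℕ) (i : Fin 2) (f : ℝ → E) :
    ∫ x, f x ∂genMeasure N i =
      ∑ k ∈ (genPoly N i).support, (genPoly N i).coeff k • f (k / lam ^ N) := by
  rw [genMeasure, integral_finsetSum_measure]
  · simp [integral_smul_nnreal_measure]
  · intro k _
    exact (integrable_dirac (by simp)).smul_measure_nnreal

theorem integral_exp_genMeasure (N : ℕ) (i : Fin 2) (z : ℂ) :
    ∫ x, Complex.exp (-(z * x)) ∂genMeasure N i = genC N z i := by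
  have h : Complex.exp (-(2 * z / lam ^ N)) = Complex.exp (-(z / lam ^ N)) ^ 2 := by
    rw [← Complex.exp_nat_mul]; congr 1; push_cast; ring
  rw [genC, h, ← aeval_genPoly, Polynomial.aeval_def, Polynomial.eval₂_eq_sum,
    Polynomial.sum, integral_genMeasure]
  refine Finset.sum_congr rfl fun k _ ↦ ?_
  rw [Algebra.smul_def, ← Complex.exp_nat_mul]
  congr 2
  push_cast
  ring

theorem genMeasure_Iio (N : ℕ) (i : Fin 2) : genMeasure N i (Set.Iio 0) = 0 := by
  rw [genMeasure, Measure.finsetSum_apply]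
  refine Finset.sum_eq_zero fun k _ ↦ ?_
  have : ¬ (k / lam ^ N : ℝ) < 0 := not_lt.2 (by have := lam_pos; positivity)
  simp [this]

instance instIsProbabilityMeasureGenMeasure (N : ℕ) (i : Fin 2) :
    IsProbabilityMeasure (genMeasure N i) := by
  have : IsFiniteMeasure (genMeasure N i) := by
    unfold genMeasure
    infer_instance
  constructor
  have h := integral_exp_genMeasure N i 0
  have h1 : genC N 0 i = 1 := by
    have := norm_genC_sub_one_le N (z := 0) le_rfl i
    simpa [sub_eq_zero] using this
  rw [h1] at h
  simpa [measureReal_def, ENNReal.toReal_eq_one_iff] using h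

theorem charFun_genMeasure (N : ℕ) (i : Fin 2) (t : ℝ) :
    charFun (genMeasure N i) t = genC N (-(t * Complex.I)) i := by
  rw [← integral_exp_genMeasure, charFun_apply_real]
  congr 1 with x
  congr 1
  ring

theorem integral_exp_genMeasure_real (N : ℕ) (i : Fin 2) (t : ℝ) :
    ∫ x, Real.exp (-(t * x)) ∂genMeasure N i = G i N t := by
  have := integral_exp_genMeasure N i t
  rw [← ofReal_G] at this
  rw [← Complex.ofReal_inj, ← this, ← integral_complex_ofReal]
  simp

theorem exists_limit_measure : ∃ (μ : Fin 2 → ProbabilityMeasure ℝ) (u : Fin 2 → ℝ),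
    (∀ i, 0 < u i) ∧ (∀ i, (μ i : Measure ℝ) (Set.Iio 0) = 0) ∧
    (∀ i (t : ℝ), 0 ≤ t → Tendsto (fun N ↦ G i N t) atTop (𝓝 (∫ x, Real.exp (-(t * x)) ∂(μ i)))) ∧
    (∀ i (t : ℝ), ‖charFun (μ i : Measure ℝ) t - 1 - t * u i * Complex.I‖ ≤ 96 * t ^ 2 * eigvec i) ∧
    ∀ i (t : ℝ), charFun (μ i : Measure ℝ) (lam * t) =
      offspring i (charFun (μ 0 : Measure ℝ) t) (charFun (μ 1 : Measure ℝ) t) := by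
  obtain ⟨φ, u, hu, hφ, hφu⟩ := exists_genC_limit
  have hre (t : ℝ) : 0 ≤ (-(t * Complex.I)).re := by simp
  have hnorm (t : ℝ) : ‖-(t * Complex.I)‖ ^ 2 = t ^ 2 := by simp
  have hzero (i) : φ 0 i = 1 := by
    have := hφu 0 le_rfl i
    simpa [sub_eq_zero] using this
  have hcont (i) : ContinuousAt (fun t : ℝ ↦ φ (-(t * Complex.I)) i) 0 := by
    have h1 : Tendsto (fun t : ℝ ↦ φ (-(t * Complex.I)) i - 1 + -(t * Complex.I) * u i) (𝓝 0)
        (𝓝 0) := by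
      refine squeeze_zero_norm (fun t ↦ hφu _ (hre t) i) ?_
      have : Continuous fun t : ℝ ↦ 96 * ‖-(t * Complex.I)‖ ^ 2 * eigvec i := by fun_prop
      simpa using this.tendsto 0
    have h2 : Tendsto (fun t : ℝ ↦ 1 + t * Complex.I * u i) (𝓝 0) (𝓝 1) := by
      have : Continuous fun t : ℝ ↦ 1 + t * Complex.I * u i := by fun_prop
      simpa using this.tendsto 0
    have h3 := h1.add h2
    rw [ContinuousAt]
    simp only [Complex.ofReal_zero, zero_mul, neg_zero, hzero]
    rw [zero_add] at h3
    refine h3.congr fun t ↦ by ring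
  have hex (i) := exists_tendsto_of_tendsto_charFun (μ := fun N ↦ ⟨genMeasure N i, inferInstance⟩)
    (hcont i) fun t ↦ by
      simpa only [ProbabilityMeasure.coe_mk, charFun_genMeasure] using hφ _ (hre t) i
  choose μ hμ hμφ using hex
  have hIio (i) : (μ i : Measure ℝ) (Set.Iio 0) = 0 := by
    have := ProbabilityMeasure.le_liminf_measure_open_of_tendsto (hμ i) (isOpen_Iio (a := (0:ℝ)))
    simpa [genMeasure_Iio] using this
  refine ⟨μ, u, hu, hIio, fun i t ht ↦ ?_, fun i t ↦ ?_, fun i t ↦ ?_⟩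
  · let f : BoundedContinuousFunction ℝ ℝ := .ofNormedAddCommGroup
      (fun x ↦ Real.exp (-(t * max x 0))) (by fun_prop) 1 (fun x ↦ by
        rw [Real.norm_of_nonneg (Real.exp_pos _).le, Real.exp_le_one_iff]
        have := mul_nonneg ht (le_max_right x 0)
        linarith)
    have hf {ν : Measure ℝ} (hν : ν (Set.Iio 0) = 0) :
        ∫ x, f x ∂ν = ∫ x, Real.exp (-(t * x)) ∂ν := by
      refine integral_congr_ae ?_
      have : ∀ᵐ x ∂ν, 0 ≤ x := by
        rw [ae_iff]
        simp only [not_le]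
        exact hν
      filter_upwards [this] with x hx
      simp [f, max_eq_left hx]
    have := ProbabilityMeasure.tendsto_iff_forall_integral_tendsto.1 (hμ i) f
    rw [hf (hIio i)] at this
    refine this.congr fun N ↦ ?_
    rw [ProbabilityMeasure.coe_mk, hf (genMeasure_Iio N i), integral_exp_genMeasure_real]
  · have := hφu _ (hre t) i
    rw [hnorm] at this
    rw [hμφ]
    convert this using 2
    ring
  · rw [hμφ, hμφ, hμφ]
    refine tendsto_nhds_unique ((hφ _ (hre _) i).comp (tendsto_add_atTop_nat 1)) ?_
    have hdiv : -((lam * t : ℝ) * Complex.I) / lam = -(t * Complex.I) := by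
      have : (lam : ℂ) ≠ 0 := by exact_mod_cast lam_pos.ne'
      push_cast
      field_simp
    simp only [Function.comp_def, genC_succ, hdiv]
    have hc : Continuous fun p : ℂ × ℂ ↦ offspring i p.1 p.2 := by
      match i with
      | 0 => simp only [offspring_zero_complex]; fun_prop
      | 1 => simp only [offspring_one_complex]; fun_prop
    exact (hc.tendsto _).comp ((hφ _ (hre t) 0).prodMk_nhds (hφ _ (hre t) 1))

theorem eq_one_of_norm_le_one_of_re {a : ℂ} (ha : ‖a‖ ≤ 1) (hre : a.re = 1) : a = 1 := by
  have h1 : a.re ^ 2 + a.im ^ 2 ≤ 1 := by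
    have : ‖a‖ ^ 2 ≤ 1 := pow_le_one₀ (norm_nonneg _) ha
    rw [← Complex.normSq_eq_norm_sq, Complex.normSq_apply] at this
    linarith
  refine Complex.ext hre (pow_eq_zero_iff two_ne_zero |>.1 ?_)
  rw [hre] at h1
  exact le_antisymm (by linarith) (sq_nonneg _)

theorem eq_one_of_norm_offspring_eq_one {i : Fin 2} {x y : ℂ} (hx : ‖x‖ ≤ 1) (hy : ‖y‖ ≤ 1)
    (h : ‖offspring i x y‖ = 1) : x = 1 ∧ y = 1 := by
  obtain ⟨w, hw⟩ : ∃ w, w = starRingEnd ℂ (offspring i x y) := ⟨_, rfl⟩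
  have hwn : ‖w‖ ≤ 1 := by rw [hw, RCLike.norm_conj, h]
  have hww : w * offspring i x y = 1 := by
    rw [hw, ← Complex.normSq_eq_conj_mul_self, Complex.normSq_eq_norm_sq, h]; simp
  have hmul {a b : ℂ} (ha : ‖a‖ ≤ 1) (hb : ‖b‖ ≤ 1) : ‖a * b‖ ≤ 1 := by
    rw [norm_mul]; exact mul_le_one₀ ha (norm_nonneg _) hb
  have hre {a : ℂ} (ha : ‖a‖ ≤ 1) : a.re ≤ 1 := (Complex.re_le_norm a).trans ha
  have hxx := hmul (hmul hwn hx) hx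
  have hxy := hmul (hmul hwn hx) hy
  have hyy := hmul (hmul hwn hy) hy
  have hxxx := hmul hxx hx
  have hxxy := hmul hxx hy
  have hxyy := hmul hxy hy
  have key : (w * x * x).re = 1 ∧ (w * x * x * x).re = 1 ∧ (w * x * y).re = 1 := by
    have := hre hxx
    have := hre hxy
    have := hre hyy
    have := hre hxxx
    have := hre hxxy
    have := hre hxyy
    match i with
    | 0 =>
      have e : (15 : ℝ) * (w * x * x) + (8 : ℝ) * (w * x * y) + w * y * y +
          (2 : ℝ) * (w * x * x * y) + (4 : ℝ) * (w * x * x * x) = (30 : ℝ) := by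
        rw [offspring_zero_complex] at hww
        push_cast
        linear_combination 30 * hww
      have := congrArg Complex.re e
      simp only [Complex.add_re, Complex.re_ofReal_mul, Complex.ofReal_re] at this
      refine ⟨?_, ?_, ?_⟩ <;> linarith
    | 1 =>
      have e : (5 : ℝ) * (w * x * x) + (11 : ℝ) * (w * x * y) + (2 : ℝ) * (w * y * y) +
          (14 : ℝ) * (w * x * x * y) + (8 : ℝ) * (w * x * x * x) + (5 : ℝ) * (w * x * y * y) =
          (45 : ℝ) := by
        rw [offspring_one_complex] at hww
        push_cast
        linear_combination 45 * hww
      have := congrArg Complex.re e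
      simp only [Complex.add_re, Complex.re_ofReal_mul, Complex.ofReal_re] at this
      refine ⟨?_, ?_, ?_⟩ <;> linarith
  have h1 := eq_one_of_norm_le_one_of_re hxx key.1
  have h2 := eq_one_of_norm_le_one_of_re hxxx key.2.1
  have h3 := eq_one_of_norm_le_one_of_re hxy key.2.2
  rw [h1, one_mul] at h2
  rw [h2, mul_one] at h1 h3
  rw [mul_one] at h1
  rw [h1, one_mul] at h3
  exact ⟨h2, h3⟩

section Decay

variable {φ : Fin 2 → ℝ → ℂ}

theorem norm_lt_one_of_offspring_eq (hφ1 : ∀ i t, ‖φ i t‖ ≤ 1)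
    (hφ : ∀ i t, φ i (lam * t) = offspring i (φ 0 t) (φ 1 t)) {u C : ℝ} (hu : 0 < u)
    (hφu : ∀ t : ℝ, ‖φ 0 t - 1 - t * u * Complex.I‖ ≤ C * t ^ 2) (i : Fin 2) {t : ℝ}
    (ht : t ≠ 0) : ‖φ i t‖ < 1 := by
  refine lt_of_le_of_ne (hφ1 i t) fun h ↦ ?_
  have hl := lam_pos.ne'
  have hstep {j : Fin 2} {s : ℝ} (hs : ‖φ j s‖ = 1) : φ 0 (s / lam) = 1 := by
    rw [← mul_div_cancel₀ s hl, hφ] at hs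
    exact (eq_one_of_norm_offspring_eq_one (hφ1 _ _) (hφ1 _ _) hs).1
  have hpow (n : ℕ) : φ 0 (t / lam ^ (n + 1)) = 1 := by
    induction n with
    | zero => simpa using hstep h
    | succ n ih =>
      rw [pow_succ, ← div_div]
      exact hstep (j := 0) (by rw [ih, norm_one])
  have hle (n : ℕ) : u ≤ C * (|t| / lam ^ (n + 1)) := by
    have h0 := hφu (t / lam ^ (n + 1))
    have hs : 0 < |t| / lam ^ (n + 1) := div_pos (abs_pos.2 ht) (pow_pos lam_pos _)
    have habs : |t / lam ^ (n + 1)| = |t| / lam ^ (n + 1) := by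
      rw [abs_div, abs_of_pos (pow_pos lam_pos _)]
    rw [hpow, sub_self, zero_sub, norm_neg, norm_mul, Complex.norm_I, mul_one, norm_mul,
      Complex.norm_real, Complex.norm_real, Real.norm_of_nonneg hu.le, Real.norm_eq_abs,
      ← sq_abs, habs] at h0
    refine le_of_mul_le_mul_left (h0.trans_eq ?_) hs
    ring
  have hlim : Tendsto (fun n : ℕ ↦ C * (|t| / lam ^ (n + 1))) atTop (𝓝 (C * 0)) :=
    (tendsto_const_nhds.div_atTop ((tendsto_pow_atTop_atTop_of_one_lt
      (by linarith [lam_gt])).comp (tendsto_add_atTop_nat 1))).const_mul C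
  have := ge_of_tendsto' hlim hle
  linarith

theorem integrable_of_offspring_eq (hφc : ∀ i, Continuous (φ i)) (hφ1 : ∀ i t, ‖φ i t‖ ≤ 1)
    (hφ : ∀ i t, φ i (lam * t) = offspring i (φ 0 t) (φ 1 t))
    (hlt : ∀ i {t}, t ≠ 0 → ‖φ i t‖ < 1) (i : Fin 2) : Integrable (φ i) := by
  have hl1 : 1 < lam := by linarith [lam_gt]
  have hl := lam_pos
  obtain ⟨r, hr0, hr1, hr⟩ : ∃ r, 0 ≤ r ∧ r < 1 ∧ ∀ j t, 1 ≤ |t| → |t| ≤ lam → ‖φ j t‖ ≤ r := by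
    have hK : IsCompact (Metric.closedBall (0 : ℝ) lam ∩ {t | 1 ≤ |t|}) :=
      (isCompact_closedBall _ _).inter_right (isClosed_le continuous_const continuous_abs)
    have hne : (Metric.closedBall (0 : ℝ) lam ∩ {t | 1 ≤ |t|}).Nonempty :=
      ⟨1, by simp [hl1.le], by simp⟩
    obtain ⟨s, hs, hmax⟩ := hK.exists_isMaxOn hne
      (f := fun t ↦ max ‖φ 0 t‖ ‖φ 1 t‖) (by fun_prop)
    have hs0 : s ≠ 0 := by
      rintro rfl
      have := hs.2
      norm_num at this
    refine ⟨max ‖φ 0 s‖ ‖φ 1 s‖, by positivity, max_lt (hlt 0 hs0) (hlt 1 hs0), fun j t h1 h2 ↦ ?_⟩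
    refine le_trans ?_ (hmax ⟨by simpa using h2, h1⟩)
    fin_cases j <;> simp
  have hdec (n : ℕ) : ∀ j t, lam ^ n ≤ |t| → |t| ≤ lam ^ (n + 1) → ‖φ j t‖ ≤ r ^ 2 ^ n := by
    induction n with
    | zero => simpa using hr
    | succ n ih =>
      intro j t h1 h2
      have ht : t = lam * (t / lam) := by field_simp
      have habs : |t / lam| = |t| / lam := by rw [abs_div, abs_of_pos hl]
      have h1' : lam ^ n ≤ |t / lam| := by rwa [habs, le_div_iff₀ hl, ← pow_succ]
      have h2' : |t / lam| ≤ lam ^ (n + 1) := by rwa [habs, div_le_iff₀ hl, ← pow_succ]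
      rw [ht, hφ, pow_succ 2, pow_mul]
      exact norm_offspring_le_sq j (ih 0 _ h1' h2') (ih 1 _ h1' h2') (pow_le_one₀ hr0 hr1.le)
  obtain ⟨m, hm⟩ : ∃ m : ℕ, r ^ 2 ^ m < (lam ^ 2)⁻¹ :=
    (((tendsto_pow_atTop_nhds_zero_of_lt_one hr0 hr1).comp
      (tendsto_pow_atTop_atTop_of_one_lt one_lt_two)).eventually_lt_const (by positivity)).exists
  have hbound (t : ℝ) : t ^ 2 * ‖φ i t‖ ≤ lam ^ (2 * m) := by
    rw [← sq_abs]
    rcases le_total |t| (lam ^ m) with h | h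
    · rw [mul_comm 2, pow_mul]
      exact (mul_le_of_le_one_right (by positivity) (hφ1 i t)).trans (by gcongr)
    · obtain ⟨n, hn1, hn2⟩ := exists_nat_pow_near ((one_le_pow₀ hl1.le).trans h) hl1
      obtain ⟨k, rfl⟩ : ∃ k, n = m + k := by
        refine ⟨n - m, ?_⟩
        have : m < n + 1 := (pow_lt_pow_iff_right₀ hl1).1 (h.trans_lt hn2)
        omega
      have h1 : ‖φ i t‖ ≤ (lam ^ 2)⁻¹ ^ (k + 1) := by
        refine (hdec _ i t hn1 hn2.le).trans ?_
        rw [pow_add, pow_mul]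
        refine (pow_le_pow_left₀ (by positivity) hm.le _).trans ?_
        exact pow_le_pow_of_le_one (by positivity)
          (inv_le_one_of_one_le₀ (one_le_pow₀ hl1.le)) k.lt_two_pow_self
      calc |t| ^ 2 * ‖φ i t‖ ≤ (lam ^ (m + k + 1)) ^ 2 * (lam ^ 2)⁻¹ ^ (k + 1) := by gcongr
        _ = lam ^ (2 * m) := by
          rw [inv_pow, ← pow_mul, ← pow_mul, ← div_eq_mul_inv, div_eq_iff (by positivity),
            ← pow_add]
          ring_nf
  refine (integrable_inv_one_add_sq.const_mul (1 + lam ^ (2 * m))).mono'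
    (hφc i).aestronglyMeasurable (Eventually.of_forall fun t ↦ ?_)
  rw [← div_eq_mul_inv, le_div_iff₀ (by positivity)]
  linarith [hbound t, hφ1 i t]

end Decay

/-- The measure `μ` dominates a positive multiple of Lebesgue measure near `y`. -/
def DominatesVolumeAt (μ : Measure ℝ) (y : ℝ) : Prop :=
  ∃ ε > 0, ∃ c : ENNReal, c ≠ 0 ∧
    ∀ A, MeasurableSet A → A ⊆ Metric.ball y ε → c * volume A ≤ μ A

theorem dominatesVolumeAt_withDensity_iff {f : ℝ → ENNReal} (hf : Continuous f) {y : ℝ} :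
    DominatesVolumeAt (volume.withDensity f) y ↔ 0 < f y := by
  constructor
  · rintro ⟨ε, hε, c, hc, h⟩
    by_contra hy
    rw [not_lt, nonpos_iff_eq_zero] at hy
    obtain ⟨c', hc'0, hc'c⟩ := exists_between (pos_iff_ne_zero.2 hc)
    have hev : ∀ᶠ x in 𝓝 y, f x < c' :=
      hf.continuousAt.eventually_lt_const (hy ▸ hc'0)
    obtain ⟨δ, hδ, hδf⟩ := Metric.eventually_nhds_iff_ball.1 hev
    have hm : 0 < min δ ε := lt_min hδ hε
    have h1 := h _ measurableSet_ball (Metric.ball_subset_ball (x := y) (min_le_right δ ε))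
    rw [withDensity_apply _ measurableSet_ball] at h1
    have h2 : ∫⁻ x in Metric.ball y (min δ ε), f x ≤ c' * volume (Metric.ball y (min δ ε)) := by
      rw [← setLIntegral_const]
      exact setLIntegral_mono measurable_const fun x hx ↦
        (hδf x (Metric.ball_subset_ball (min_le_left δ ε) hx)).le
    have h3 := h1.trans h2
    rw [ENNReal.mul_le_mul_iff_left (Metric.measure_ball_pos _ _ hm).ne' measure_ball_lt_top.ne]
      at h3
    exact h3.not_gt hc'c
  · intro hy
    obtain ⟨c, hc0, hc⟩ := exists_between hy
    obtain ⟨ε, hε, h⟩ := Metric.eventually_nhds_iff_ball.1 (hf.continuousAt.eventually_const_lt hc)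
    refine ⟨ε, hε, c, hc0.ne', fun A hA hAε ↦ ?_⟩
    rw [withDensity_apply _ hA, ← setLIntegral_const]
    exact setLIntegral_mono hf.measurable fun x hx ↦ (h x (hAε hx)).le

theorem DominatesVolumeAt.mono {μ ν : Measure ℝ} {y : ℝ} (h : DominatesVolumeAt μ y)
    {c : ℝ≥0} (hc : c ≠ 0) (hle : c • μ ≤ ν) : DominatesVolumeAt ν y := by
  obtain ⟨ε, hε, d, hd, h⟩ := h
  refine ⟨ε, hε, c * d, mul_ne_zero (by simpa using hc) hd, fun A hA hAε ↦ ?_⟩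
  refine le_trans ?_ (hle A)
  rw [Measure.smul_apply, mul_assoc, ENNReal.smul_def, smul_eq_mul]
  gcongr
  exact h A hA hAε

theorem DominatesVolumeAt.conv {μ ν : Measure ℝ} [SFinite μ] [SFinite ν] {y z : ℝ}
    (hμ : DominatesVolumeAt μ y) (hν : DominatesVolumeAt ν z) :
    DominatesVolumeAt (μ ∗ ν) (y + z) := by
  obtain ⟨ε, hε, c, hc, h⟩ := hμ
  obtain ⟨ε', hε', c', hc', h'⟩ := hν
  have hδ : 0 < min (ε / 2) ε' := lt_min (half_pos hε) hε'
  refine ⟨min (ε / 2) ε', hδ, c' * volume (Metric.ball z (min (ε / 2) ε')) * c,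
    mul_ne_zero (mul_ne_zero hc' (Metric.measure_ball_pos _ _ hδ).ne') hc, fun A hA hAs ↦ ?_⟩
  rw [Measure.conv_comm, Measure.conv, Measure.map_apply (by fun_prop) hA,
    Measure.prod_apply (hA.preimage (by fun_prop))]
  refine le_trans ?_ (setLIntegral_le_lintegral (Metric.ball z (min (ε / 2) ε')) _)
  calc c' * volume (Metric.ball z (min (ε / 2) ε')) * c * volume A
      ≤ c * volume A * ν (Metric.ball z (min (ε / 2) ε')) := by
        rw [mul_assoc, mul_comm]
        gcongr
        exact h' _ measurableSet_ball (Metric.ball_subset_ball (min_le_right _ _))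
    _ ≤ _ := by
        rw [← setLIntegral_const]
        refine setLIntegral_mono' measurableSet_ball fun w hw ↦ ?_
        have hA' : MeasurableSet ((w + ·) ⁻¹' A) := hA.preimage (by fun_prop)
        refine le_trans ?_ (h _ hA' fun x hx ↦ ?_)
        · exact (congrArg (c * ·) (measure_preimage_add volume w A)).ge
        · have h1 : dist (w + x) (y + z) < ε / 2 := lt_of_lt_of_le (hAs hx) (min_le_left _ _)
          have h2 : dist w z < ε / 2 := lt_of_lt_of_le hw (min_le_left _ _)
          rw [Real.dist_eq, abs_lt] at h1 h2
          rw [Metric.mem_ball, Real.dist_eq, abs_lt]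
          constructor <;> linarith

theorem DominatesVolumeAt.of_map_mul {μ : Measure ℝ} {y r : ℝ} (hr : 0 < r)
    (h : DominatesVolumeAt (μ.map (r * ·)) y) : DominatesVolumeAt μ (y / r) := by
  obtain ⟨ε, hε, c, hc, h⟩ := h
  refine ⟨ε / r, div_pos hε hr, c * ENNReal.ofReal r, mul_ne_zero hc (by simpa using hr),
    fun A hA hAs ↦ ?_⟩
  have hA' : MeasurableSet ((r⁻¹ * ·) ⁻¹' A) := hA.preimage (by fun_prop)
  have hv : volume ((r⁻¹ * ·) ⁻¹' A) = ENNReal.ofReal r * volume A := by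
    rw [Real.volume_preimage_mul_left (inv_ne_zero hr.ne'), inv_inv, abs_of_pos hr]
  have hp : (r * ·) ⁻¹' ((r⁻¹ * ·) ⁻¹' A) = A := by
    ext x; simp [hr.ne']
  have := h _ hA' fun x hx ↦ by
    have h1 : dist (r⁻¹ * x) (y / r) < ε / r := hAs hx
    rw [Real.dist_eq, inv_mul_eq_div, ← sub_div, abs_div, abs_of_pos hr] at h1
    rw [Metric.mem_ball, Real.dist_eq]
    exact (div_lt_div_iff_of_pos_right hr).1 h1
  rwa [Measure.map_apply (by fun_prop) hA', hp, hv, ← mul_assoc] at this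

theorem charFun_add_measure {μ ν : Measure ℝ} [IsFiniteMeasure μ] [IsFiniteMeasure ν] (t : ℝ) :
    charFun (μ + ν) t = charFun μ t + charFun ν t := by
  simp only [charFun_apply_real]
  have (ρ : Measure ℝ) [IsFiniteMeasure ρ] :
      Integrable (fun x : ℝ ↦ Complex.exp (t * x * Complex.I)) ρ := by
    refine Integrable.of_bound (C := 1) (by fun_prop) (ae_of_all _ fun x ↦ ?_)
    rw [← Complex.ofReal_mul, Complex.norm_exp_ofReal_mul_I]
  exact integral_add_measure (this μ) (this ν)

theorem charFun_nnreal_smul_measure (c : ℝ≥0) (μ : Measure ℝ) (t : ℝ) :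
    charFun (c • μ) t = c * charFun μ t := by
  simp only [charFun_apply_real, integral_smul_nnreal_measure]
  rfl

theorem map_lam_mul_eq {μ : Fin 2 → Measure ℝ} [∀ i, IsProbabilityMeasure (μ i)]
    (h : ∀ i (t : ℝ), charFun (μ i) (lam * t) = offspring i (charFun (μ 0) t) (charFun (μ 1) t)) :
    (μ 0).map (lam * ·) = (15 / 30 : ℝ≥0) • (μ 0 ∗ μ 0) + (4 / 30 : ℝ≥0) • (μ 0 ∗ μ 0 ∗ μ 0) +
      ((8 / 30 : ℝ≥0) • (μ 0 ∗ μ 1) + (1 / 30 : ℝ≥0) • (μ 1 ∗ μ 1) +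
        (2 / 30 : ℝ≥0) • (μ 0 ∗ μ 0 ∗ μ 1)) ∧
    (μ 1).map (lam * ·) = (5 / 45 : ℝ≥0) • (μ 0 ∗ μ 0) +
      ((11 / 45 : ℝ≥0) • (μ 0 ∗ μ 1) + (2 / 45 : ℝ≥0) • (μ 1 ∗ μ 1) +
        (14 / 45 : ℝ≥0) • (μ 0 ∗ μ 0 ∗ μ 1) + (8 / 45 : ℝ≥0) • (μ 0 ∗ μ 0 ∗ μ 0) +
        (5 / 45 : ℝ≥0) • (μ 0 ∗ μ 1 ∗ μ 1)) := by
  constructor <;> refine Measure.ext_of_charFun (funext fun t ↦ ?_)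
  · rw [charFun_map_mul, h, offspring_zero_complex]
    simp only [charFun_add_measure, charFun_nnreal_smul_measure, charFun_conv]
    push_cast
    ring
  · rw [charFun_map_mul, h, offspring_one_complex]
    simp only [charFun_add_measure, charFun_nnreal_smul_measure, charFun_conv]
    push_cast
    ring

theorem mul_div_lam_pow_mem {O : Set ℝ} (h2 : ∀ y ∈ O, ∀ z ∈ O, (y + z) / lam ∈ O)
    (h3 : ∀ y ∈ O, ∀ z ∈ O, ∀ w ∈ O, (y + (z + w)) / lam ∈ O) {y : ℝ} (hy : y ∈ O) (n : ℕ) :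
    ∀ k : ℕ, 2 ^ n ≤ k → k ≤ 3 ^ n → k * y / lam ^ n ∈ O := by
  have hpow (n : ℕ) : 3 * 2 ^ n ≤ 2 * 3 ^ n + 1 := by
    induction n with
    | zero => norm_num
    | succ n ih =>
      have : 0 < 3 ^ n := by positivity
      rw [pow_succ, pow_succ]
      omega
  induction n with
  | zero =>
    intro k h1 h2
    obtain rfl : k = 1 := le_antisymm h2 h1
    simpa using hy
  | succ n ih =>
    intro k hk1 hk2
    have := hpow n
    rw [pow_succ] at hk1 hk2
    rcases le_or_gt k (2 * 3 ^ n) with hk | hk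
    · have := h2 _ (ih (k / 2) (by omega) (by omega)) _ (ih (k - k / 2) (by omega) (by omega))
      rw [Nat.cast_sub (Nat.div_le_self k 2)] at this
      convert this using 1
      rw [pow_succ]
      field_simp
      ring
    · have := h3 _ (ih (k / 3) (by omega) (by omega)) _ (ih ((k + 1) / 3) (by omega) (by omega))
        _ (ih ((k + 2) / 3) (by omega) (by omega))
      have hsum : k = k / 3 + ((k + 1) / 3 + (k + 2) / 3) := by omega
      have hsum' : (k : ℝ) = (k / 3 : ℕ) + (((k + 1) / 3 : ℕ) + ((k + 2) / 3 : ℕ)) := by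
        exact_mod_cast hsum
      convert this using 1
      rw [hsum', pow_succ]
      field_simp

theorem Ioi_subset_of_isOpen {O : Set ℝ} (hO : IsOpen O)
    (h2 : ∀ y ∈ O, ∀ z ∈ O, (y + z) / lam ∈ O)
    (h3 : ∀ y ∈ O, ∀ z ∈ O, ∀ w ∈ O, (y + (z + w)) / lam ∈ O) {y : ℝ} (hy0 : 0 < y)
    (hy : y ∈ O) : Set.Ioi 0 ⊆ O := by
  intro x hx
  rw [Set.mem_Ioi] at hx
  have hl := lam_pos
  have hs : Tendsto (fun n : ℕ ↦ lam ^ n * (x / y)) atTop atTop :=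
    (tendsto_pow_atTop_atTop_of_one_lt (by linarith [lam_gt])).atTop_mul_const (by positivity)
  have hlim : Tendsto (fun n : ℕ ↦ y / (⌈lam ^ n * (x / y)⌉₊ / (lam ^ n * (x / y)))) atTop
      (𝓝 (y / 1)) :=
    tendsto_const_nhds.div (tendsto_nat_ceil_div_atTop.comp hs) one_ne_zero
  rw [div_one] at hlim
  have e1 := hlim.eventually (hO.mem_nhds hy)
  have e2 : ∀ᶠ n : ℕ in atTop, y / x ≤ (lam / 2) ^ n :=
    (tendsto_pow_atTop_atTop_of_one_lt (by linarith [lam_gt])).eventually_ge_atTop _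
  have e3 : ∀ᶠ n : ℕ in atTop, x / y ≤ (3 / lam) ^ n :=
    (tendsto_pow_atTop_atTop_of_one_lt
      ((one_lt_div hl).2 (by linarith [lam_lt]))).eventually_ge_atTop _
  obtain ⟨n, hn1, hn2, hn3⟩ := (e1.and (e2.and e3)).exists
  have hspos : 0 < lam ^ n * (x / y) := by positivity
  have hceil : (0 : ℝ) < ⌈lam ^ n * (x / y)⌉₊ := by exact_mod_cast Nat.ceil_pos.2 hspos
  have := mul_div_lam_pow_mem h2 h3 hn1 n ⌈lam ^ n * (x / y)⌉₊ ?_ ?_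
  · convert this using 1
    field_simp
  · have : (2 : ℝ) ^ n ≤ lam ^ n * (x / y) := by
      rw [div_pow, div_le_div_iff₀ hx (by positivity)] at hn2
      rw [← mul_div_assoc, le_div_iff₀ hy0]
      linarith
    exact_mod_cast this.trans (Nat.le_ceil _)
  · rw [Nat.ceil_le]
    push_cast
    rw [div_pow, div_le_div_iff₀ hy0 (by positivity)] at hn3
    rw [← mul_div_assoc, div_le_iff₀ hy0]
    linarith

theorem density_pos {μ : Fin 2 → Measure ℝ} [∀ i, IsProbabilityMeasure (μ i)]
    (h : ∀ i (t : ℝ), charFun (μ i) (lam * t) = offspring i (charFun (μ 0) t) (charFun (μ 1) t))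
    (h0 : μ 0 (Set.Iic 0) = 0) {f : Fin 2 → ℝ → ENNReal} (hf : ∀ i, Continuous (f i))
    (hμ : ∀ i, μ i = volume.withDensity (f i)) (i : Fin 2) {x : ℝ} (hx : 0 < x) :
    0 < f i x := by
  obtain ⟨hmap0, hmap1⟩ := map_lam_mul_eq h
  have hiff (i y) : DominatesVolumeAt (μ i) y ↔ 0 < f i y := by
    rw [hμ, dominatesVolumeAt_withDensity_iff (hf i)]
  have h2 (y) (hy : 0 < f 0 y) (z) (hz : 0 < f 0 z) : 0 < f 0 ((y + z) / lam) := by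
    rw [← hiff] at *
    refine .of_map_mul lam_pos ((hy.conv hz).mono (c := 15 / 30) (by norm_num) ?_)
    rw [hmap0, add_assoc]
    exact Measure.le_add_right le_rfl
  have h3 (y) (hy : 0 < f 0 y) (z) (hz : 0 < f 0 z) (w) (hw : 0 < f 0 w) :
      0 < f 0 ((y + (z + w)) / lam) := by
    rw [← hiff] at *
    refine .of_map_mul lam_pos ((hy.conv (hz.conv hw)).mono (c := 4 / 30) (by norm_num) ?_)
    rw [hmap0, ← Measure.conv_assoc]
    exact Measure.le_add_right (Measure.le_add_left le_rfl)
  obtain ⟨y, hy0, hy⟩ : ∃ y, 0 < y ∧ 0 < f 0 y := by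
    by_contra! hcon
    have h1 : μ 0 (Set.Ioi 0) = 0 := by
      rw [hμ, withDensity_apply _ measurableSet_Ioi]
      refine (setLIntegral_congr_fun measurableSet_Ioi fun y hy ↦ ?_).trans lintegral_zero
      simpa using hcon y hy
    have : μ 0 Set.univ = 0 := by
      rw [← Set.Iic_union_Ioi (a := (0 : ℝ))]
      exact measure_union_null h0 h1
    simp at this
  have hpos0 : Set.Ioi 0 ⊆ {y | 0 < f 0 y} :=
    Ioi_subset_of_isOpen (isOpen_lt continuous_const (hf 0)) h2 h3 hy0 hy
  match i with
  | 0 => exact hpos0 hx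
  | 1 =>
    have hl := lam_pos
    have hz : 0 < f 0 (lam * x / 2) := hpos0 (by simp; positivity)
    have hxz : x = (lam * x / 2 + lam * x / 2) / lam := by field_simp; ring
    rw [hxz]
    rw [← hiff] at *
    refine .of_map_mul lam_pos ((hz.conv hz).mono (c := 5 / 45) (by norm_num) ?_)
    rw [hmap1]
    exact Measure.le_add_right le_rfl

theorem integrable_id_of_laplace {μ : Measure ℝ} [IsProbabilityMeasure μ]
    (h0 : μ (Set.Iic 0) = 0) {C : ℝ}
    (h : ∀ t : ℝ, 0 < t → 1 - C * t ≤ ∫ x, Real.exp (-(t * x)) ∂μ) :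
    Integrable (fun x : ℝ ↦ x) μ := by
  have hpos : ∀ᵐ x ∂μ, 0 < x := by
    rw [ae_iff]
    simp only [not_lt]
    exact h0
  let s (n : ℕ) : ℝ := 1 / (n + 1)
  have hs (n) : 0 < s n := by positivity
  have hlim (x : ℝ) : Tendsto (fun n ↦ ENNReal.ofReal ((s n)⁻¹ * (1 - Real.exp (-(s n * x)))))
      atTop (𝓝 (ENNReal.ofReal x)) := by
    refine (ENNReal.continuous_ofReal.tendsto x).comp ?_
    have hd : HasDerivAt (fun t ↦ Real.exp (-(t * x))) (-x) 0 := by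
      simpa using (((hasDerivAt_id (0 : ℝ)).mul_const x).neg).exp
    have hs0 : Tendsto s atTop (𝓝[≠] 0) :=
      tendsto_nhdsWithin_iff.2 ⟨tendsto_one_div_add_atTop_nhds_zero_nat,
        Eventually.of_forall fun n ↦ (hs n).ne'⟩
    have := (hd.tendsto_slope_zero.comp hs0).neg
    rw [neg_neg] at this
    refine this.congr fun n ↦ ?_
    simp
    ring
  refine ⟨by fun_prop, ?_⟩
  rw [hasFiniteIntegral_iff_norm]
  have hnorm : ∫⁻ x, ENNReal.ofReal ‖x‖ ∂μ = ∫⁻ x, ENNReal.ofReal x ∂μ :=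
    lintegral_congr_ae (hpos.mono fun x hx ↦ by simp only [Real.norm_of_nonneg hx.le])
  rw [hnorm]
  calc ∫⁻ x, ENNReal.ofReal x ∂μ
      = ∫⁻ x, liminf (fun n ↦ ENNReal.ofReal ((s n)⁻¹ * (1 - Real.exp (-(s n * x))))) atTop ∂μ := by
        simp only [fun x ↦ (hlim x).liminf_eq]
    _ ≤ liminf (fun n ↦ ∫⁻ x, ENNReal.ofReal ((s n)⁻¹ * (1 - Real.exp (-(s n * x)))) ∂μ) atTop :=
        lintegral_liminf_le fun n ↦ by fun_prop
    _ ≤ ENNReal.ofReal C := by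
        refine liminf_le_of_le (by isBoundedDefault) fun b hb ↦ ?_
        obtain ⟨n, hn⟩ := hb.exists
        refine hn.trans ?_
        have hint : Integrable (fun x ↦ Real.exp (-(s n * x))) μ := by
          refine Integrable.of_bound (C := 1) (by fun_prop) (hpos.mono fun x hx ↦ ?_)
          rw [Real.norm_of_nonneg (Real.exp_pos _).le, Real.exp_le_one_iff]
          have := mul_pos (hs n) hx
          linarith
        have hint' : Integrable (fun x ↦ (s n)⁻¹ * (1 - Real.exp (-(s n * x)))) μ :=
          ((integrable_const 1).sub hint).const_mul _
        rw [← ofReal_integral_eq_lintegral_ofReal hint' ?_]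
        · refine ENNReal.ofReal_le_ofReal ?_
          rw [integral_const_mul, integral_sub (integrable_const 1) hint]
          simp only [integral_const, probReal_univ, smul_eq_mul, mul_one]
          rw [inv_mul_le_iff₀ (hs n)]
          linarith [h (s n) (hs n)]
        · filter_upwards [hpos] with x hx
          have := mul_pos (hs n) hx
          refine mul_nonneg (inv_nonneg.2 (hs n).le) (sub_nonneg.2 (Real.exp_le_one_iff.2 ?_))
          linarith
    _ < ⊤ := ENNReal.ofReal_lt_top

theorem one_sub_le_G (i : Fin 2) (N : ℕ) {t : ℝ} (ht : 0 ≤ t) : 1 - 4 * eigvec i * t ≤ G i N t := by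
  have h := norm_genC_sub_one_le N (z := t) (by simpa using ht) i
  rw [← ofReal_G, ← Complex.ofReal_one, ← Complex.ofReal_sub, Complex.norm_real, Complex.norm_real,
    Real.norm_of_nonneg ht] at h
  linarith [(abs_le.1 h).1]

/-- There exist Borel probability measures μ₁, μ₂ on ℝ, each giving zero mass to
(−∞, 0], each absolutely continuous w.r.t. Lebesgue measure with a density strictly
positive on (0,∞), and each with finite first moment, such that for i = 1,2 and
every t ≥ 0, G_N^{(i)}(t) → ∫ e^{−tx} μ_i(dx) as N → ∞. -/
theorem G_tendsto_laplace_transform :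
    ∃ μ : Fin 2 → Measure ℝ,
      ∀ i : Fin 2,
        IsProbabilityMeasure (μ i) ∧
        μ i (Set.Iic 0) = 0 ∧
        (∃ f : ℝ → ENNReal, Measurable f ∧ μ i = volume.withDensity f ∧
          ∀ x : ℝ, 0 < x → 0 < f x) ∧
        Integrable (fun x : ℝ => x) (μ i) ∧
        ∀ t : ℝ, 0 ≤ t →
          Filter.Tendsto (fun N : ℕ => G i N t) Filter.atTop
            (nhds (∫ x, Real.exp (-(t * x)) ∂(μ i))) := by
  obtain ⟨μ, u, hu, hIio, hG, hlin, hφ⟩ := exists_limit_measure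
  have hint (i) : Integrable (charFun (μ i : Measure ℝ)) :=
    integrable_of_offspring_eq (φ := fun i ↦ charFun (μ i : Measure ℝ))
      (fun i ↦ continuous_charFun) (fun i t ↦ norm_charFun_le_one t) hφ
      (norm_lt_one_of_offspring_eq (fun i t ↦ norm_charFun_le_one t) hφ (hu 0)
        (C := 96 * eigvec 0) fun t ↦ (hlin 0 t).trans_eq (by ring)) i
  choose F hFc _ hF using fun i ↦ exists_continuous_density_of_integrable_charFun (hint i)
  have hIic (i) : (μ i : Measure ℝ) (Set.Iic 0) = 0 := by
    rw [← Set.Iio_union_right, measure_union_null_iff]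
    refine ⟨hIio i, ?_⟩
    rw [hF]
    exact withDensity_absolutelyContinuous _ _ Real.volume_singleton
  have hfc (i) : Continuous fun x ↦ ENNReal.ofReal (F i x) :=
    ENNReal.continuous_ofReal.comp (hFc i)
  refine ⟨fun i ↦ μ i, fun i ↦ ⟨inferInstance, hIic i, ⟨_, (hfc i).measurable, hF i, fun x hx ↦
    density_pos (μ := fun i ↦ (μ i : Measure ℝ)) hφ (hIic 0) hfc hF i hx⟩, ?_, hG i⟩⟩
  exact integrable_id_of_laplace (hIic i) fun t ht ↦
    ge_of_tendsto' (hG i t ht.le) fun N ↦ one_sub_le_G i N ht.le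
end
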